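/- arXiv:2409.10908 — 4 statements merged into one kernel-verified Lean document; each statement's English description precedes it below -/
import Mathlib

section
/- There exists a constant C > 0 such that for every integer n ≥ 2, every integer k with 2 ≤ k ≤ n, and every δ ∈ (0,1), there is a non-adaptive randomized algorithm making at most C · n · log(k/δ) · (log k + log log(n/δ))² subset queries (log denoting the base-2 logarithm) which, for every partition of an n-point set U into at most k clusters, outputs exactly that partition with probability at least 1 − δ. -/
open scoped ENNReal

/-- `count(S)`: the number of clusters (under the cluster labeling `c`) intersecting
the query set `S`. -/
def clusterCount {U K : Type*} [DecidableEq K] (c : U → K) (S : Finset U) : ℕ :=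
  (S.image c).card


/-! ### Uniform probability on a finite type -/

open scoped Classical in
/-- The probability of `p` under the uniform distribution on a finite type. -/
noncomputable def uniformProb {Ω : Type*} [Fintype Ω] (p : Ω → Prop) : ℝ :=
  ((Finset.univ.filter p).card : ℝ) / Fintype.card Ω

section uniformProb

variable {Ω Ω' : Type*} [Fintype Ω] [Fintype Ω']

lemma uniformProb_eq (p : Ω → Prop) [DecidablePred p] :
    uniformProb p = ((Finset.univ.filter p).card : ℝ) / Fintype.card Ω := by
  unfold uniformProb
  congr!

lemma uniformProb_nonneg (p : Ω → Prop) : 0 ≤ uniformProb p := by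
  unfold uniformProb; positivity

lemma uniformProb_mono {p q : Ω → Prop} (h : ∀ ω, p ω → q ω) :
    uniformProb p ≤ uniformProb q := by
  classical
  unfold uniformProb
  gcongr
  apply h

lemma uniformProb_or_le (p q : Ω → Prop) :
    uniformProb (fun ω => p ω ∨ q ω) ≤ uniformProb p + uniformProb q := by
  classical
  simp only [uniformProb_eq]
  rw [← add_div]
  gcongr
  rw [Finset.filter_or]
  exact_mod_cast Finset.card_union_le _ _

lemma uniformProb_le_add_add {p q r b : Ω → Prop} {x y z : ℝ} (hp : uniformProb p ≤ x)
    (hq : uniformProb q ≤ y) (hr : uniformProb r ≤ z) (h : ∀ ω, b ω → p ω ∨ (q ω ∨ r ω)) :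
    uniformProb b ≤ x + (y + z) :=
  (uniformProb_mono h).trans ((uniformProb_or_le _ _).trans
    (add_le_add hp ((uniformProb_or_le _ _).trans (add_le_add hq hr))))

lemma uniformProb_exists_le {ι : Type*} [Fintype ι] (p : ι → Ω → Prop) {ε : ℝ}
    (h : ∀ i, uniformProb (p i) ≤ ε) :
    uniformProb (fun ω => ∃ i, p i ω) ≤ Fintype.card ι * ε := by
  classical
  calc uniformProb (fun ω => ∃ i, p i ω) ≤ ∑ i, uniformProb (p i) := by
        simp only [uniformProb_eq]
        rw [← Finset.sum_div]
        gcongr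
        have : Finset.univ.filter (fun ω => ∃ i, p i ω)
            = Finset.univ.biUnion fun i => Finset.univ.filter (p i) := by
          ext ω; simp
        rw [this]
        exact_mod_cast Finset.card_biUnion_le
    _ ≤ ∑ _i : ι, ε := Finset.sum_le_sum fun i _ => h i
    _ = Fintype.card ι * ε := by simp

lemma uniformProb_false : uniformProb (fun _ : Ω => False) = 0 := by
  simp [uniformProb]

/-- For `p ⊆ q`, the probability of `q \ p` is the difference. -/
lemma uniformProb_and_not {p q : Ω → Prop} (h : ∀ ω, p ω → q ω) :
    uniformProb (fun ω => q ω ∧ ¬ p ω) = uniformProb q - uniformProb p := by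
  classical
  simp only [uniformProb_eq]
  rw [← sub_div]
  congr 1
  rw [eq_sub_iff_add_eq, ← Nat.cast_add, ← Finset.card_union_of_disjoint]
  · congr 2
    ext ω
    simp only [Finset.mem_union, Finset.mem_filter, Finset.mem_univ, true_and]
    have := h ω
    tauto
  · rw [Finset.disjoint_filter]
    tauto

lemma uniformProb_true [Nonempty Ω] : uniformProb (fun _ : Ω => True) = 1 := by
  simp [uniformProb]

lemma uniformProb_not [Nonempty Ω] (p : Ω → Prop) :
    uniformProb (fun ω => ¬ p ω) = 1 - uniformProb p := by
  rw [← uniformProb_true (Ω := Ω), ← uniformProb_and_not (fun _ _ => trivial)]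
  simp

lemma uniformProb_fst [Nonempty Ω'] (p : Ω → Prop) :
    uniformProb (fun ω : Ω × Ω' => p ω.1) = uniformProb p := by
  classical
  unfold uniformProb
  have : Finset.univ.filter (fun ω : Ω × Ω' => p ω.1)
      = (Finset.univ.filter p) ×ˢ Finset.univ := by
    ext ω; simp
  rw [this, Finset.card_product, Fintype.card_prod, Finset.card_univ, Nat.cast_mul, Nat.cast_mul,
    mul_div_mul_right]
  exact_mod_cast Fintype.card_ne_zero

/-- A bound that holds conditionally on the first coordinate holds unconditionally. -/
lemma uniformProb_prod_le [Nonempty Ω] [Nonempty Ω'] (p : Ω × Ω' → Prop) {ε : ℝ}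
    (h : ∀ a, uniformProb (fun b => p (a, b)) ≤ ε) : uniformProb p ≤ ε := by
  classical
  have hΩ : (0 : ℝ) < Fintype.card Ω := by exact_mod_cast Fintype.card_pos
  have hΩ' : (0 : ℝ) < Fintype.card Ω' := by exact_mod_cast Fintype.card_pos
  have hcard : ((Finset.univ.filter p).card : ℝ)
      = ∑ a : Ω, ((Finset.univ.filter fun b => p (a, b)).card : ℝ) := by
    simp only [Finset.card_filter, Nat.cast_sum]
    rw [← Finset.univ_product_univ, Finset.sum_product]
  unfold uniformProb at h ⊢
  rw [hcard, Fintype.card_prod, Nat.cast_mul, div_le_iff₀ (by positivity)]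
  calc ∑ a : Ω, ((Finset.univ.filter fun b => p (a, b)).card : ℝ)
      ≤ ∑ _a : Ω, ε * Fintype.card Ω' :=
        Finset.sum_le_sum fun a _ => (div_le_iff₀ hΩ').1 (h a)
    _ = ε * (Fintype.card Ω * Fintype.card Ω') := by
        rw [Finset.sum_const, Finset.card_univ, nsmul_eq_mul]; ring

/-- Independence of the coordinates. -/
lemma uniformProb_pi {ι : Type*} [Fintype ι] [DecidableEq ι] {α : ι → Type*}
    [∀ i, Fintype (α i)] [∀ i, Nonempty (α i)] (I : Finset ι) (p : ∀ i, α i → Prop) :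
    uniformProb (fun ω : (∀ i, α i) => ∀ i ∈ I, p i (ω i)) = ∏ i ∈ I, uniformProb (p i) := by
  classical
  have hset : Finset.univ.filter (fun ω : (∀ i, α i) => ∀ i ∈ I, p i (ω i))
      = Fintype.piFinset fun i => Finset.univ.filter fun a => i ∈ I → p i a := by
    ext ω; simp
  have hI : ∏ i ∈ I, uniformProb (p i) = ∏ i, uniformProb fun a : α i => i ∈ I → p i a := by
    rw [← Finset.prod_subset (Finset.subset_univ I)]
    · refine Finset.prod_congr rfl fun i hi => ?_
      simp [hi]
    · intro i _ hi
      simp [hi, uniformProb_true]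
  rw [hI]
  simp only [uniformProb_eq]
  rw [hset, Fintype.card_piFinset, Fintype.card_pi, Finset.prod_div_distrib, Nat.cast_prod,
    Nat.cast_prod]

/-- The chance that independent trials all lie in sets of probability at most `r`. -/
lemma uniformProb_pi_le_pow {ι : Type*} [Fintype ι] [DecidableEq ι] {α : ι → Type*}
    [∀ i, Fintype (α i)] [∀ i, Nonempty (α i)] (I : Finset ι) (p : ∀ i, α i → Prop) {r : ℝ}
    (h : ∀ i ∈ I, uniformProb (p i) ≤ r) :
    uniformProb (fun ω : (∀ i, α i) => ∀ i ∈ I, p i (ω i)) ≤ r ^ I.card := by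
  rw [uniformProb_pi]
  calc ∏ i ∈ I, uniformProb (p i) ≤ ∏ _i ∈ I, r :=
        Finset.prod_le_prod (fun i _ => uniformProb_nonneg _) h
    _ = r ^ I.card := Finset.prod_const r
end uniformProb

/-! ### Random subsets -/

section randomSubset

variable {U : Type*} [Fintype U]

/-- The set of points to which `f` gives the value `0`; for uniform `f` this is a random set
containing each point independently with probability `1 / s`. -/
def zeroSet {s : ℕ} (f : U → Fin s) : Finset U :=
  Finset.univ.filter fun x => (f x : ℕ) = 0

lemma mem_zeroSet {s : ℕ} {f : U → Fin s} {x : U} : x ∈ zeroSet f ↔ (f x : ℕ) = 0 := by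
  simp [zeroSet]

variable [DecidableEq U]

lemma uniformProb_disjoint_zeroSet {s : ℕ} [NeZero s] (X : Finset U) :
    uniformProb (fun f : U → Fin s => Disjoint X (zeroSet f)) = (1 - 1 / (s : ℝ)) ^ X.card := by
  have hone : uniformProb (fun a : Fin s => ¬ (a : ℕ) = 0) = 1 - 1 / (s : ℝ) := by
    rw [uniformProb_not]
    congr 1
    have : Finset.univ.filter (fun a : Fin s => (a : ℕ) = 0) = {0} := by
      ext a; simp
    rw [uniformProb_eq, this]
    simp
  have h := uniformProb_pi (α := fun _ : U => Fin s) X fun _ a => ¬ (a : ℕ) = 0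
  rw [hone, Finset.prod_const] at h
  rw [← h]
  simp only [Finset.disjoint_left, mem_zeroSet]

lemma uniformProb_hit_miss {s : ℕ} [NeZero s] {A B : Finset U} (hAB : Disjoint A B) :
    uniformProb (fun f : U → Fin s => Disjoint B (zeroSet f) ∧ ¬ Disjoint A (zeroSet f))
      = (1 - 1 / (s : ℝ)) ^ B.card * (1 - (1 - 1 / (s : ℝ)) ^ A.card) := by
  have h := uniformProb_and_not (Ω := U → Fin s)
    (p := fun f => Disjoint (A ∪ B) (zeroSet f)) (q := fun f => Disjoint B (zeroSet f))
    (fun f hf => (Finset.disjoint_union_left.1 hf).2)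
  rw [uniformProb_disjoint_zeroSet, uniformProb_disjoint_zeroSet,
    Finset.card_union_of_disjoint hAB] at h
  rw [show (1 - 1 / (s : ℝ)) ^ B.card * (1 - (1 - 1 / (s : ℝ)) ^ A.card)
    = (1 - 1 / (s : ℝ)) ^ B.card - (1 - 1 / (s : ℝ)) ^ (A.card + B.card) by ring, ← h]
  congr 1
  ext f
  rw [Finset.disjoint_union_left]
  tauto

lemma half_le_one_sub_inv_pow {s b : ℕ} [NeZero s] (h : 2 * b ≤ s) :
    1 / 2 ≤ (1 - 1 / (s : ℝ)) ^ b := by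
  have hs : (1 : ℝ) ≤ s := by exact_mod_cast NeZero.one_le
  have h1 : 1 / (s : ℝ) ≤ 1 := by rw [div_le_one (by linarith)]; exact hs
  have hB := one_add_mul_le_pow (a := -(1 / (s : ℝ))) (by linarith) b
  have h2 : (b : ℝ) * (1 / s) ≤ 1 / 2 := by
    rw [mul_one_div, div_le_iff₀ (by linarith)]
    have : (2 * b : ℝ) ≤ s := by exact_mod_cast h
    linarith
  calc (1 / 2 : ℝ) ≤ 1 + b * -(1 / (s : ℝ)) := by linarith
    _ ≤ _ := hB
    _ = _ := by rw [← sub_eq_add_neg]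

lemma one_sub_inv_pow_mul_le (s M : ℕ) [NeZero s] :
    (1 - 1 / (s : ℝ)) ^ (s * M) ≤ (1 / 2) ^ M := by
  have hs : (1 : ℝ) ≤ s := by exact_mod_cast NeZero.one_le
  have h1 : 1 / (s : ℝ) ≤ 1 := by rw [div_le_one (by linarith)]; exact hs
  rw [pow_mul]
  refine pow_le_pow_left₀ (pow_nonneg (by linarith) _) ?_ M
  calc (1 - 1 / (s : ℝ)) ^ s ≤ Real.exp (-1) :=
        Real.one_sub_div_pow_le_exp_neg hs
    _ ≤ 1 / 2 := by
        rw [Real.exp_neg, one_div]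
        apply inv_anti₀ (by norm_num)
        linarith [Real.add_one_le_exp (1 : ℝ)]

lemma one_sub_inv_pow_le {s a : ℕ} [NeZero s] (h : s ≤ 4 * a) :
    (1 - 1 / (s : ℝ)) ^ a ≤ 4 / 5 := by
  have hs : (1 : ℝ) ≤ s := by exact_mod_cast NeZero.one_le
  have h1 : 1 / (s : ℝ) ≤ 1 := by rw [div_le_one (by linarith)]; exact hs
  have h0 : (0 : ℝ) ≤ 1 - 1 / (s : ℝ) := by linarith
  have hpos : (0 : ℝ) < 1 / s := by positivity
  have hB := one_add_mul_le_pow (a := 1 / (s : ℝ)) (by linarith) a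
  have h2 : (1 / 4 : ℝ) ≤ a * (1 / s) := by
    rw [mul_one_div, le_div_iff₀ (by linarith)]
    have : (s : ℝ) ≤ 4 * a := by exact_mod_cast h
    linarith
  have h3 : (1 - 1 / (s : ℝ)) ^ a * (1 + 1 / (s : ℝ)) ^ a ≤ 1 := by
    rw [← mul_pow]
    apply pow_le_one₀
    · apply mul_nonneg h0; positivity
    · nlinarith
  nlinarith [pow_nonneg h0 a]

/-- If `A` is the larger of two disjoint sets, then a random set of density about `1 / |A|`
fails to separate them with probability at most `9 / 10`. -/
lemma uniformProb_not_hit_miss_le {s : ℕ} [NeZero s] {A B : Finset U} (hAB : Disjoint A B)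
    (hBs : 2 * B.card ≤ s) (hAs : s ≤ 4 * A.card) :
    uniformProb (fun f : U → Fin s => ¬ (Disjoint B (zeroSet f) ∧ ¬ Disjoint A (zeroSet f)))
      ≤ 9 / 10 := by
  rw [uniformProb_not, uniformProb_hit_miss hAB]
  have h1 := half_le_one_sub_inv_pow hBs
  have h2 := one_sub_inv_pow_le hAs
  nlinarith

/-- A random set of density `1 / (2 K)` isolates a point from a set of size at most `K` with
probability at least `1 / (4 K)`. -/
lemma uniformProb_not_isolate_le {K : ℕ} [NeZero (2 * K)] {W : Finset U} {x : U} (hx : x ∉ W)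
    (hW : W.card ≤ K) :
    uniformProb (fun f : U → Fin (2 * K) => ¬ (x ∈ zeroSet f ∧ Disjoint W (zeroSet f)))
      ≤ 1 - 1 / ((4 * K : ℕ) : ℝ) := by
  have h := uniformProb_hit_miss (s := 2 * K) (A := {x}) (B := W) (by simpa using hx)
  have h1 : 1 / 2 ≤ (1 - 1 / ((2 * K : ℕ) : ℝ)) ^ W.card :=
    half_le_one_sub_inv_pow (by omega)
  rw [uniformProb_not]
  have heq : uniformProb (fun f : U → Fin (2 * K) => x ∈ zeroSet f ∧ Disjoint W (zeroSet f))
      = (1 - 1 / ((2 * K : ℕ) : ℝ)) ^ W.card * (1 / ((2 * K : ℕ) : ℝ)) := by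
    rw [Finset.card_singleton, pow_one, sub_sub_cancel] at h
    rw [← h]
    congr 1
    ext f
    simp [and_comm]
  rw [heq]
  have h4 : 1 / ((4 * K : ℕ) : ℝ) = 1 / 2 * (1 / ((2 * K : ℕ) : ℝ)) := by
    push_cast
    rw [one_div_mul_one_div]
    ring
  have : 0 ≤ 1 / ((2 * K : ℕ) : ℝ) := by positivity
  rw [h4]
  nlinarith

end randomSubset

/-! ### Queries and decoding -/

section decoding

variable {U L ι₁ ι₂ κ : Type*} [DecidableEq U] [DecidableEq L]

/-- The queries built from test sets `T` and groups `G`: each test set of the first kind is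
combined with every point, each test set of the second kind with every group. -/
def testQuery (T : ι₁ ⊕ ι₂ → Finset U) (G : κ → Finset U) :
    (ι₁ × Option U) ⊕ (ι₂ × Option κ) → Finset U
  | .inl (i, none) => T (.inl i)
  | .inl (i, some x) => T (.inl i) ∪ {x}
  | .inr (i, none) => T (.inr i)
  | .inr (i, some r) => T (.inr i) ∪ G r

/-- Whether the answers certify that the cluster of `x` meets the test set `i`. -/
def CertifiedHit (G : κ → Finset U) (ans : (ι₁ × Option U) ⊕ (ι₂ × Option κ) → ℕ) :
    ι₁ ⊕ ι₂ → U → Prop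
  | .inl i, x => ans (.inl (i, some x)) = ans (.inl (i, none))
  | .inr i, x => ∃ r, x ∈ G r ∧ ans (.inr (i, some r)) = ans (.inr (i, none))

/-- Two points are declared equivalent when the same test sets are certified for them. -/
def decode (G : κ → Finset U) (ans : (ι₁ × Option U) ⊕ (ι₂ × Option κ) → ℕ) : Setoid U :=
  Setoid.ker fun x i => CertifiedHit G ans i x

lemma clusterCount_union_eq_iff (c : U → L) (T S : Finset U) :
    clusterCount c (T ∪ S) = clusterCount c T ↔ ∀ y ∈ S, c y ∈ T.image c := by
  unfold clusterCount
  rw [Finset.image_union]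
  constructor
  · intro h y hy
    have := Finset.eq_of_subset_of_card_le
      (Finset.subset_union_left (s₁ := T.image c) (s₂ := S.image c)) h.le
    rw [this]
    exact Finset.mem_union_right _ (Finset.mem_image_of_mem c hy)
  · intro h
    rw [Finset.union_eq_left.2]
    exact Finset.image_subset_iff.2 h

lemma certifiedHit_iff {c : U → L} {T : ι₁ ⊕ ι₂ → Finset U} {G : κ → Finset U}
    (hiso : ∀ (i : ι₂) (x : U), c x ∈ (T (.inr i)).image c →
      ∃ r, x ∈ G r ∧ ∀ y ∈ G r, c y ∈ (T (.inr i)).image c) (i : ι₁ ⊕ ι₂) (x : U) :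
    CertifiedHit G (fun q => clusterCount c (testQuery T G q)) i x ↔ c x ∈ (T i).image c := by
  rcases i with i | i
  · simp only [CertifiedHit, testQuery, clusterCount_union_eq_iff, Finset.mem_singleton,
      forall_eq]
  · simp only [CertifiedHit, testQuery, clusterCount_union_eq_iff]
    exact ⟨fun ⟨_, hx, h⟩ => h x hx, hiso i x⟩

lemma decode_eq_ker {c : U → L} {T : ι₁ ⊕ ι₂ → Finset U} {G : κ → Finset U}
    (hiso : ∀ (i : ι₂) (x : U), c x ∈ (T (.inr i)).image c →
      ∃ r, x ∈ G r ∧ ∀ y ∈ G r, c y ∈ (T (.inr i)).image c)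
    (hsep : ∀ x y, c x ≠ c y → ∃ i, ¬ (c x ∈ (T i).image c ↔ c y ∈ (T i).image c)) :
    decode G (fun q => clusterCount c (testQuery T G q)) = Setoid.ker c := by
  ext x y
  rw [decode, Setoid.ker_def, Setoid.ker_def, funext_iff]
  simp only [certifiedHit_iff hiso, eq_iff_iff]
  constructor
  · intro h
    by_contra hne
    obtain ⟨i, hi⟩ := hsep x y hne
    exact hi (h i)
  · intro h i
    rw [h]

end decoding

/-! ### Failure probability of the random design -/

section design

variable {U L : Type*} [Fintype U] [DecidableEq L]

/-- The cluster with label `p`. -/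
def cluster (c : U → L) (p : L) : Finset U :=
  Finset.univ.filter fun x => c x = p

lemma mem_image_iff_not_disjoint_cluster (c : U → L) (T : Finset U) (p : L) :
    p ∈ T.image c ↔ ¬ Disjoint (cluster c p) T := by
  rw [Finset.not_disjoint_iff]
  simp [cluster, and_comm]

variable [DecidableEq U]

lemma uniformProb_not_separated_le {ι : Type*} [Fintype ι] [DecidableEq ι] {s : ι → ℕ}
    [∀ i, NeZero (s i)] {t : ℕ} (c : U → L)
    (hs : ∀ a, 1 ≤ a → a ≤ Fintype.card U →
      ∃ I : Finset ι, I.card = t ∧ ∀ i ∈ I, 2 * a ≤ s i ∧ s i ≤ 4 * a) {p q : L} (hpq : p ≠ q)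
    (hp : (cluster c p).Nonempty) (hle : (cluster c q).card ≤ (cluster c p).card) :
    uniformProb (fun ω : ∀ i, U → Fin (s i) => ∀ i,
        (Disjoint (cluster c p) (zeroSet (ω i)) ↔ Disjoint (cluster c q) (zeroSet (ω i))))
      ≤ (9 / 10) ^ t := by
  obtain ⟨I, rfl, hI⟩ := hs _ hp.card_pos (Finset.card_le_univ _)
  have hdisj : Disjoint (cluster c p) (cluster c q) := by
    rw [Finset.disjoint_left]
    intro x hx hx'
    simp only [cluster, Finset.mem_filter, Finset.mem_univ, true_and] at hx hx'
    exact hpq (hx.symm.trans hx')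
  refine (uniformProb_mono ?_).trans (uniformProb_pi_le_pow (α := fun i => U → Fin (s i)) I
    (fun i f => ¬ (Disjoint (cluster c q) (zeroSet f) ∧ ¬ Disjoint (cluster c p) (zeroSet f)))
    fun i hi => ?_)
  · intro ω h i _ h'
    exact h'.2 ((h i).2 h'.1)
  · exact uniformProb_not_hit_miss_le hdisj (by have := (hI i hi).1; omega) (hI i hi).2

variable [Fintype L]

lemma uniformProb_exists_not_separated_le {ι : Type*} [Fintype ι] [DecidableEq ι] {s : ι → ℕ}
    [∀ i, NeZero (s i)] {t : ℕ} (c : U → L)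
    (hs : ∀ a, 1 ≤ a → a ≤ Fintype.card U →
      ∃ I : Finset ι, I.card = t ∧ ∀ i ∈ I, 2 * a ≤ s i ∧ s i ≤ 4 * a) :
    uniformProb (fun ω : ∀ i, U → Fin (s i) => ∃ x y, c x ≠ c y ∧ ∀ i,
        (c x ∈ (zeroSet (ω i)).image c ↔ c y ∈ (zeroSet (ω i)).image c))
      ≤ (Fintype.card L : ℝ) ^ 2 * (9 / 10) ^ t := by
  have h := uniformProb_exists_le (ε := (9 / 10) ^ t)
    (fun (pq : L × L) (ω : ∀ i, U → Fin (s i)) =>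
      (pq.1 ≠ pq.2 ∧ (cluster c pq.1).Nonempty ∧ (cluster c pq.2).Nonempty) ∧
      ∀ i, (Disjoint (cluster c pq.1) (zeroSet (ω i)) ↔
        Disjoint (cluster c pq.2) (zeroSet (ω i)))) ?_
  · rw [Fintype.card_prod, Nat.cast_mul, ← sq] at h
    refine (uniformProb_mono ?_).trans h
    rintro ω ⟨x, y, hxy, hi⟩
    refine ⟨(c x, c y), ⟨hxy, ⟨x, by simp [cluster]⟩, ⟨y, by simp [cluster]⟩⟩, fun i => ?_⟩
    have := hi i
    rw [mem_image_iff_not_disjoint_cluster, mem_image_iff_not_disjoint_cluster] at this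
    exact not_iff_not.1 this
  · rintro ⟨p, q⟩
    by_cases hne : p ≠ q ∧ (cluster c p).Nonempty ∧ (cluster c q).Nonempty
    · rcases le_total (cluster c q).card (cluster c p).card with hle | hle
      · exact (uniformProb_mono fun ω h => h.2).trans
          (uniformProb_not_separated_le c hs hne.1 hne.2.1 hle)
      · exact (uniformProb_mono fun ω h i => (h.2 i).symm).trans
          (uniformProb_not_separated_le c hs hne.1.symm hne.2.2 hle)
    · refine (uniformProb_mono (q := fun _ => False) fun ω h => hne h.1).trans ?_
      rw [uniformProb_false]
      positivity

lemma uniformProb_exists_large_missed_le {ι₁ ι₂ : Type*} [Fintype ι₁] [Fintype ι₂]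
    [DecidableEq ι₁] [DecidableEq ι₂] {s : ι₁ ⊕ ι₂ → ℕ} [∀ i, NeZero (s i)] {S M : ℕ}
    (hS : ∀ i, s (.inr i) ≤ S) (c : U → L) :
    uniformProb (fun ω : ∀ i, U → Fin (s i) => ∃ ip : ι₂ × L,
        S * M ≤ (cluster c ip.2).card ∧ Disjoint (cluster c ip.2) (zeroSet (ω (.inr ip.1))))
      ≤ Fintype.card ι₂ * Fintype.card L * (1 / 2) ^ M := by
  rw [← Nat.cast_mul, ← Fintype.card_prod]
  refine uniformProb_exists_le _ fun ⟨i, p⟩ => ?_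
  by_cases hp : S * M ≤ (cluster c p).card
  · have h := uniformProb_pi_le_pow (α := fun i => U → Fin (s i)) {Sum.inr i}
      (fun i f => Disjoint (cluster c p) (zeroSet f)) (r := (1 / 2) ^ M) ?_
    · rw [Finset.card_singleton, pow_one] at h
      refine (uniformProb_mono ?_).trans h
      rintro ω ⟨_, hω⟩ j hj
      rw [Finset.mem_singleton] at hj
      subst hj
      exact hω
    · intro j hj
      rw [Finset.mem_singleton] at hj
      subst hj
      rw [uniformProb_disjoint_zeroSet]
      refine le_trans ?_ (one_sub_inv_pow_mul_le (s (.inr i)) M)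
      have hs : (1 : ℝ) ≤ s (.inr i) := by exact_mod_cast NeZero.one_le
      have h1 : 1 / (s (.inr i) : ℝ) ≤ 1 := by rw [div_le_one (by linarith)]; exact hs
      refine pow_le_pow_of_le_one (by linarith) ?_ ((Nat.mul_le_mul_right M (hS i)).trans hp)
      have : 0 ≤ 1 / (s (.inr i) : ℝ) := by positivity
      linarith
  · refine (uniformProb_mono (q := fun _ => False) fun ω h => hp h.1).trans ?_
    rw [uniformProb_false]
    positivity

lemma uniformProb_forall_not_isolate_le {κ : Type*} [Fintype κ] [DecidableEq κ] {K M : ℕ}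
    [NeZero K] (hκ : Fintype.card κ = 4 * K * M) {W : Finset U} {x : U} (hx : x ∉ W)
    (hW : W.card ≤ K) :
    uniformProb (fun g : κ → U → Fin (2 * K) =>
        ∀ r, ¬ (x ∈ zeroSet (g r) ∧ Disjoint W (zeroSet (g r))))
      ≤ (1 / 2) ^ M := by
  have h := uniformProb_pi_le_pow (α := fun _ : κ => U → Fin (2 * K)) Finset.univ
    (fun _ f => ¬ (x ∈ zeroSet f ∧ Disjoint W (zeroSet f)))
    fun _ _ => uniformProb_not_isolate_le hx hW
  rw [Finset.card_univ, hκ] at h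
  refine le_trans (uniformProb_mono ?_) (h.trans (one_sub_inv_pow_mul_le (4 * K) M))
  intro ω hω i _
  exact hω i

/-- The points whose cluster misses `T`. -/
def missedPoints (c : U → L) (T : Finset U) : Finset U :=
  Finset.univ.filter fun x => c x ∉ T.image c

lemma card_missedPoints_le {c : U → L} {T : Finset U} {N : ℕ}
    (h : ∀ p, Disjoint (cluster c p) T → (cluster c p).card ≤ N) :
    (missedPoints c T).card ≤ Fintype.card L * N := by
  have hsub : missedPoints c T ⊆
      (Finset.univ.filter fun p => Disjoint (cluster c p) T).biUnion (cluster c) := by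
    intro x hx
    simp only [missedPoints, Finset.mem_filter, Finset.mem_univ, true_and,
      mem_image_iff_not_disjoint_cluster, not_not] at hx
    simp only [Finset.mem_biUnion, Finset.mem_filter, Finset.mem_univ, true_and]
    exact ⟨c x, hx, by simp [cluster]⟩
  calc (missedPoints c T).card ≤ _ := Finset.card_le_card hsub
    _ ≤ (Finset.univ.filter fun p => Disjoint (cluster c p) T).card * N :=
        Finset.card_biUnion_le_card_mul _ _ _ fun p hp => h p (Finset.mem_filter.1 hp).2
    _ ≤ Fintype.card L * N := Nat.mul_le_mul_right _ (Finset.card_le_univ _)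

/-- Some pair of clusters is not distinguished by the test sets. -/
def Unseparated {ι : Type*} {s : ι → ℕ} (c : U → L) (ω : ∀ i, U → Fin (s i)) : Prop :=
  ∃ x y, c x ≠ c y ∧ ∀ i, (c x ∈ (zeroSet (ω i)).image c ↔ c y ∈ (zeroSet (ω i)).image c)

/-- Some cluster of size at least `N` misses a test set of the second kind. -/
def LargeMissed {ι₁ ι₂ : Type*} {s : ι₁ ⊕ ι₂ → ℕ} (c : U → L) (N : ℕ)
    (ω : ∀ i, U → Fin (s i)) : Prop :=
  ∃ ip : ι₂ × L, N ≤ (cluster c ip.2).card ∧ Disjoint (cluster c ip.2) (zeroSet (ω (.inr ip.1)))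

/-- All large clusters are hit, but some point whose cluster is hit lies in no group all of
whose points have hit clusters. -/
def NotIsolated {ι₁ ι₂ κ : Type*} {s : ι₁ ⊕ ι₂ → ℕ} {K : ℕ} (c : U → L) (N : ℕ)
    (ω : ∀ i, U → Fin (s i)) (g : κ → U → Fin (2 * K)) : Prop :=
  ∃ ix : ι₂ × U, (¬ LargeMissed c N ω ∧ ix.2 ∉ missedPoints c (zeroSet (ω (.inr ix.1)))) ∧
    ∀ r, ¬ (ix.2 ∈ zeroSet (g r) ∧
      Disjoint (missedPoints c (zeroSet (ω (.inr ix.1)))) (zeroSet (g r)))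

/-- Failure probability of the random design for a fixed clustering. -/
lemma uniformProb_decode_ne_le {ι₁ ι₂ κ : Type*} [Fintype ι₁] [Fintype ι₂] [Fintype κ]
    [DecidableEq ι₁] [DecidableEq ι₂] [DecidableEq κ] {s : ι₁ ⊕ ι₂ → ℕ} [∀ i, NeZero (s i)]
    {t S M K : ℕ} [NeZero K]
    (hs : ∀ a, 1 ≤ a → a ≤ Fintype.card U →
      ∃ I : Finset (ι₁ ⊕ ι₂), I.card = t ∧ ∀ i ∈ I, 2 * a ≤ s i ∧ s i ≤ 4 * a)
    (hS : ∀ i, s (.inr i) ≤ S) (hK : Fintype.card L * (S * M) ≤ K)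
    (hκ : Fintype.card κ = 4 * K * M) (c : U → L) :
    uniformProb (fun ω : (∀ i, U → Fin (s i)) × (κ → U → Fin (2 * K)) =>
        decode (fun r => zeroSet (ω.2 r)) (fun q => clusterCount c
          (testQuery (fun i => zeroSet (ω.1 i)) (fun r => zeroSet (ω.2 r)) q)) ≠ Setoid.ker c)
      ≤ (Fintype.card L : ℝ) ^ 2 * (9 / 10) ^ t
        + (Fintype.card ι₂ * Fintype.card L * (1 / 2) ^ M
          + Fintype.card ι₂ * Fintype.card U * (1 / 2) ^ M) := by
  have h₁ : uniformProb (fun ω : (∀ i, U → Fin (s i)) × (κ → U → Fin (2 * K)) =>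
      Unseparated c ω.1)
      ≤ (Fintype.card L : ℝ) ^ 2 * (9 / 10) ^ t := by
    rw [uniformProb_fst]
    exact uniformProb_exists_not_separated_le c hs
  have h₂ : uniformProb (fun ω : (∀ i, U → Fin (s i)) × (κ → U → Fin (2 * K)) =>
      LargeMissed c (S * M) ω.1)
      ≤ Fintype.card ι₂ * Fintype.card L * (1 / 2) ^ M := by
    rw [uniformProb_fst]
    exact uniformProb_exists_large_missed_le hS c
  have h₃ : uniformProb (fun ω : (∀ i, U → Fin (s i)) × (κ → U → Fin (2 * K)) =>
      NotIsolated c (S * M) ω.1 ω.2)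
      ≤ Fintype.card ι₂ * Fintype.card U * (1 / 2) ^ M := by
    refine uniformProb_prod_le _ fun ω => ?_
    rw [← Nat.cast_mul, ← Fintype.card_prod]
    refine uniformProb_exists_le _ fun ⟨i, x⟩ => ?_
    by_cases h : ¬ LargeMissed c (S * M) ω ∧ x ∉ missedPoints c (zeroSet (ω (.inr i)))
    · refine (uniformProb_mono fun g hg => hg.2).trans
        (uniformProb_forall_not_isolate_le hκ h.2 ((card_missedPoints_le ?_).trans hK))
      intro p hp
      by_contra hlt
      exact h.1 ⟨(i, p), (not_le.1 hlt).le, hp⟩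
    · refine (uniformProb_mono (q := fun _ => False) fun g hg => h hg.1).trans ?_
      rw [uniformProb_false]
      positivity
  refine uniformProb_le_add_add h₁ h₂ h₃ fun ω hω => ?_
  by_contra hgood
  rw [not_or, not_or] at hgood
  obtain ⟨g₁, g₂, g₃⟩ := hgood
  refine hω (decode_eq_ker ?_ ?_)
  · intro i x hx
    by_contra hno
    refine g₃ ⟨(i, x), ⟨g₂, by simpa [missedPoints] using hx⟩, ?_⟩
    rintro r ⟨hxr, hdisj⟩
    refine hno ⟨r, hxr, fun y hy => ?_⟩
    by_contra hy'
    exact Finset.disjoint_left.1 hdisj (by simpa [missedPoints] using hy') hy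
  · intro x y hxy
    by_contra hno
    exact g₁ ⟨x, y, hxy, fun i => by_contra fun h => hno ⟨i, h⟩⟩

end design

/-- A random design on a uniform finite sample space yields a non-adaptive algorithm. -/
lemma exists_pmf_of_uniformProb_le {U L Ω Q : Type*} [DecidableEq L] [Fintype Ω] [Nonempty Ω]
    [Fintype Q] (query : Ω → Q → Finset U) (dec : Ω → (Q → ℕ) → Setoid U) {δ : ℝ}
    (h : ∀ c : U → L, uniformProb
      (fun ω => dec ω (fun q => clusterCount c (query ω q)) ≠ Setoid.ker c) ≤ δ) :
    ∃ D : PMF ((Fin (Fintype.card Q) → Finset U) × ((Fin (Fintype.card Q) → ℕ) → Setoid U)),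
      ∀ c : U → L, ENNReal.ofReal (1 - δ) ≤
        D.toOuterMeasure {a | a.2 (fun i => clusterCount c (a.1 i)) = Setoid.ker c} := by
  classical
  let e := Fintype.equivFin Q
  refine ⟨(PMF.uniformOfFintype Ω).map fun ω =>
    (fun i => query ω (e.symm i), fun ans => dec ω (ans ∘ e)), fun c => ?_⟩
  rw [PMF.toOuterMeasure_map_apply, PMF.toOuterMeasure_uniformOfFintype_apply]
  have hc := h c
  rw [uniformProb_not] at hc
  have hset : ((fun ω => ((fun i => query ω (e.symm i), fun ans => dec ω (ans ∘ e)) :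
      (Fin (Fintype.card Q) → Finset U) × ((Fin (Fintype.card Q) → ℕ) → Setoid U))) ⁻¹'
        {a | a.2 (fun i => clusterCount c (a.1 i)) = Setoid.ker c})
      = {ω | dec ω (fun q => clusterCount c (query ω q)) = Setoid.ker c} := by
    ext ω
    simp [Function.comp_def]
  simp only [hset]
  refine (ENNReal.ofReal_le_ofReal (by linarith :
    1 - δ ≤ uniformProb fun ω => dec ω (fun q => clusterCount c (query ω q)) =
      Setoid.ker c)).trans ?_
  rw [uniformProb_eq, ENNReal.ofReal_div_of_pos (by exact_mod_cast Fintype.card_pos),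
    ENNReal.ofReal_natCast, ENNReal.ofReal_natCast, Fintype.card_subtype]
  simp

/-! ### Choice of parameters -/

/-- Every cluster size is within a constant factor of one of the scales of the design. -/
lemma exists_scale_finset {D j₀ t a : ℕ} (ha : 1 ≤ a) (haD : Nat.log 2 a < j₀ + D) :
    ∃ I : Finset ((Fin D × Fin t) ⊕ (Fin j₀ × Fin t)), I.card = t ∧ ∀ i ∈ I,
      2 * a ≤ Sum.elim (fun d : Fin D × Fin t => 2 ^ (j₀ + d.1 + 2))
        (fun j : Fin j₀ × Fin t => 2 ^ ((j.1 : ℕ) + 2)) i ∧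
      Sum.elim (fun d : Fin D × Fin t => 2 ^ (j₀ + d.1 + 2))
        (fun j : Fin j₀ × Fin t => 2 ^ ((j.1 : ℕ) + 2)) i ≤ 4 * a := by
  have h1 : 2 ^ Nat.log 2 a ≤ a := Nat.pow_log_le_self 2 (by omega)
  have h2 : a < 2 ^ (Nat.log 2 a + 1) := Nat.lt_pow_succ_log_self (by norm_num) a
  rw [pow_succ] at h2
  have h3 : 2 ^ (Nat.log 2 a + 2) = 4 * 2 ^ Nat.log 2 a := by ring
  by_cases hj : Nat.log 2 a < j₀
  · let f : Fin t ↪ (Fin D × Fin t) ⊕ (Fin j₀ × Fin t) :=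
      ⟨fun i => .inr (⟨_, hj⟩, i), fun i i' h => by simpa using h⟩
    refine ⟨Finset.univ.map f, by simp, fun i hi => ?_⟩
    obtain ⟨i', -, rfl⟩ := Finset.mem_map.1 hi
    change 2 * a ≤ 2 ^ (Nat.log 2 a + 2) ∧ 2 ^ (Nat.log 2 a + 2) ≤ 4 * a
    omega
  · have hd : Nat.log 2 a - j₀ < D := by omega
    let f : Fin t ↪ (Fin D × Fin t) ⊕ (Fin j₀ × Fin t) :=
      ⟨fun i => .inl (⟨_, hd⟩, i), fun i i' h => by simpa using h⟩
    refine ⟨Finset.univ.map f, by simp, fun i hi => ?_⟩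
    obtain ⟨i', -, rfl⟩ := Finset.mem_map.1 hi
    change 2 * a ≤ 2 ^ (j₀ + (Nat.log 2 a - j₀) + 2) ∧
      2 ^ (j₀ + (Nat.log 2 a - j₀) + 2) ≤ 4 * a
    rw [Nat.add_sub_cancel' (not_lt.1 hj)]
    omega

/-- The algorithm with `D` dense scales, `j₀` sparse scales and `t` test sets per scale. -/
lemma exists_pmf_of_scales {n k D j₀ t M : ℕ} (hk : 0 < k) (hM : 0 < M)
    (hD : Nat.log 2 n < j₀ + D) {δ : ℝ}
    (hδ : (k : ℝ) ^ 2 * (9 / 10) ^ t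
      + ((j₀ * t : ℕ) * k * (1 / 2) ^ M + (j₀ * t : ℕ) * n * (1 / 2) ^ M) ≤ δ) :
    ∃ m : ℕ, m = D * t * (n + 1) + j₀ * t * (4 * (k * (2 ^ (j₀ + 1) * M)) * M + 1) ∧
      ∃ D : PMF ((Fin m → Finset (Fin n)) × ((Fin m → ℕ) → Setoid (Fin n))),
        ∀ c : Fin n → Fin k, ENNReal.ofReal (1 - δ) ≤
          D.toOuterMeasure {a | a.2 (fun i => clusterCount c (a.1 i)) = Setoid.ker c} := by
  let s : (Fin D × Fin t) ⊕ (Fin j₀ × Fin t) → ℕ :=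
    Sum.elim (fun d => 2 ^ (j₀ + d.1 + 2)) (fun j => 2 ^ ((j.1 : ℕ) + 2))
  have hs0 : ∀ i, NeZero (s i) := by
    rintro (i | i) <;> exact ⟨by simp [s]⟩
  set K := k * (2 ^ (j₀ + 1) * M) with hK
  have hK0 : NeZero K := ⟨by positivity⟩
  have hfail := uniformProb_decode_ne_le (U := Fin n) (L := Fin k) (κ := Fin (4 * K * M))
    (s := s) (t := t) (S := 2 ^ (j₀ + 1)) (M := M) (K := K)
    (fun a ha han => exists_scale_finset ha
      ((Nat.log_mono_right (han.trans_eq (Fintype.card_fin n))).trans_lt hD))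
    (fun i => Nat.pow_le_pow_right (by norm_num) (by omega)) (by simp [hK]) (by simp)
  simp only [Fintype.card_fin, Fintype.card_prod] at hfail
  refine ⟨_, ?_, exists_pmf_of_uniformProb_le
    (fun ω : (∀ i, Fin n → Fin (s i)) × (Fin (4 * K * M) → Fin n → Fin (2 * K)) =>
      testQuery (fun i => zeroSet (ω.1 i)) (fun r => zeroSet (ω.2 r)))
    (fun ω => decode (fun r => zeroSet (ω.2 r))) fun c => (hfail c).trans hδ⟩
  simp

lemma log_parameters {n k : ℕ} (hk : 2 ≤ k) (hkn : k ≤ n) {δ : ℝ} (hδ : 0 < δ)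
    (hδ1 : δ < 1) :
    1 ≤ Real.logb 2 k ∧ 1 ≤ Real.logb 2 (k / δ) ∧ 1 ≤ Real.logb 2 (n / δ) ∧
      Real.logb 2 (k / δ) ≤ Real.logb 2 (n / δ) := by
  have hk' : (2 : ℝ) ≤ k := by exact_mod_cast hk
  have hkn' : (k : ℝ) ≤ n := by exact_mod_cast hkn
  have hkδ : (k : ℝ) ≤ k / δ := le_div_self (by linarith) hδ hδ1.le
  have h1 : 1 ≤ Real.logb 2 k := by
    rw [Real.le_logb_iff_rpow_le (by norm_num) (by linarith)]; simpa using hk'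
  have h2 : Real.logb 2 k ≤ Real.logb 2 (k / δ) :=
    Real.logb_le_logb_of_le (by norm_num) (by linarith) hkδ
  have h3 : Real.logb 2 (k / δ) ≤ Real.logb 2 (n / δ) :=
    Real.logb_le_logb_of_le (by norm_num) (by linarith) (by gcongr)
  exact ⟨h1, by linarith, by linarith, h3⟩

lemma mul_half_pow_ceil_logb_le {x δ : ℝ} (hx : 0 < x) (hδ : 0 < δ) :
    x * (1 / 2) ^ ⌈Real.logb 2 (x / δ)⌉₊ ≤ δ := by
  have h : x / δ ≤ 2 ^ ⌈Real.logb 2 (x / δ)⌉₊ := by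
    rw [← Real.rpow_natCast, ← Real.logb_le_iff_le_rpow (by norm_num) (by positivity)]
    exact Nat.le_ceil _
  rw [div_le_iff₀ hδ] at h
  rw [one_div, inv_pow, ← div_eq_mul_inv, div_le_iff₀ (by positivity)]
  linarith

lemma sq_mul_pow_le {k h : ℕ} (hh : 1 ≤ h) {δ : ℝ} (hδ1 : δ < 1)
    (hkh : (k : ℝ) * (1 / 2) ^ h ≤ δ) : (k : ℝ) ^ 2 * (9 / 10) ^ (28 * h) ≤ δ / 4 := by
  set u : ℝ := (1 / 2) ^ h with hu
  have hu0 : 0 ≤ u := by positivity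
  have hu1 : u ≤ 1 / 2 := by
    calc u ≤ (1 / 2) ^ 1 := pow_le_pow_of_le_one (by norm_num) (by norm_num) hh
      _ = 1 / 2 := pow_one _
  have h0 : 0 ≤ (k : ℝ) * u := by positivity
  have h9 : ((9 : ℝ) / 10) ^ (28 * h) ≤ u ^ 4 := by
    rw [hu, ← pow_mul, mul_comm h 4, pow_mul, pow_mul]
    exact pow_le_pow_left₀ (by norm_num) (by norm_num) h
  calc (k : ℝ) ^ 2 * (9 / 10) ^ (28 * h) ≤ k ^ 2 * u ^ 4 := by gcongr
    _ = (k * u) * (k * u) * u ^ 2 := by ring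
    _ ≤ δ * 1 * (1 / 2) ^ 2 :=
        mul_le_mul (mul_le_mul hkh (hkh.trans hδ1.le) h0 (h0.trans hkh))
          (pow_le_pow_left₀ hu0 hu1 2) (by positivity) (by linarith [h0.trans hkh])
    _ = δ / 4 := by ring

lemma mul_half_pow_le {n j h H : ℕ} (hH : 1 ≤ H) (hj : j ≤ 2 * H) (hhH : h ≤ H) {δ : ℝ}
    (hnH : (n : ℝ) * (1 / 2) ^ H ≤ δ) :
    ((j * (28 * h) : ℕ) : ℝ) * n * (1 / 2) ^ (20 * H) ≤ δ / 4 := by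
  set u : ℝ := (1 / 2) ^ H with hu
  have hu0 : 0 ≤ u := by positivity
  have hu1 : u ≤ 1 / 2 := by
    calc u ≤ (1 / 2) ^ 1 := pow_le_pow_of_le_one (by norm_num) (by norm_num) hH
      _ = 1 / 2 := pow_one _
  have hHu : (H : ℝ) * u ≤ 1 := by
    rw [hu, one_div, inv_pow, ← div_eq_mul_inv, div_le_one (by positivity)]
    exact_mod_cast (Nat.lt_two_pow_self).le
  have hδ : 0 ≤ δ := le_trans (by positivity) hnH
  have hcast : ((j * (28 * h) : ℕ) : ℝ) ≤ 56 * H * H := by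
    have : j * (28 * h) ≤ 2 * H * (28 * H) := by gcongr
    calc ((j * (28 * h) : ℕ) : ℝ) ≤ ((2 * H * (28 * H) : ℕ) : ℝ) := by exact_mod_cast this
      _ = 56 * H * H := by push_cast; ring
  calc ((j * (28 * h) : ℕ) : ℝ) * n * (1 / 2) ^ (20 * H) ≤ 56 * H * H * n * u ^ 20 := by
        rw [mul_comm 20 H, pow_mul]; gcongr
    _ = 56 * (n * u) * (H * u) * (H * u) * u ^ 17 := by ring
    _ ≤ 56 * δ * 1 * 1 * (1 / 2) ^ 17 := by gcongr
    _ ≤ δ / 4 := by norm_num; linarith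

lemma query_count_le {n k M t j₀ J D m : ℕ} (hn : 1 ≤ n)
    (hj₀ : j₀ = Nat.log 2 (n / (8 * k * M ^ 2 * J))) (hjJ : j₀ ≤ J) (hJn : J ≤ n)
    (hm : m = D * t * (n + 1) + j₀ * t * (4 * (k * (2 ^ (j₀ + 1) * M)) * M + 1)) :
    m ≤ 2 * t * n * (D + 1) := by
  have hsparse : j₀ * (4 * (k * (2 ^ (j₀ + 1) * M)) * M + 1) ≤ 2 * n := by
    rcases Nat.eq_zero_or_pos j₀ with h0 | hpos
    · simp [h0]
    · have hne : n / (8 * k * M ^ 2 * J) ≠ 0 := by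
        intro h
        rw [h] at hj₀
        simp at hj₀
        omega
      have h1 : 2 ^ j₀ ≤ n / (8 * k * M ^ 2 * J) := by
        conv_lhs => rw [hj₀]
        exact Nat.pow_log_le_self 2 hne
      have h2 := (Nat.mul_le_mul_right (8 * k * M ^ 2 * J) h1).trans (Nat.div_mul_le_self _ _)
      calc j₀ * (4 * (k * (2 ^ (j₀ + 1) * M)) * M + 1)
          ≤ J * (4 * (k * (2 ^ (j₀ + 1) * M)) * M + 1) := by gcongr
        _ = 2 ^ j₀ * (8 * k * M ^ 2 * J) + J := by ring
        _ ≤ 2 * n := by omega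
  calc m = D * t * (n + 1) + t * (j₀ * (4 * (k * (2 ^ (j₀ + 1) * M)) * M + 1)) := by
        rw [hm]; ring
    _ ≤ D * t * (2 * n) + t * (2 * n) := by gcongr; omega
    _ = 2 * t * n * (D + 1) := by ring

lemma dense_scales_le {n k H J j₀ D : ℕ} (hn : 1 ≤ n) (hk : 1 ≤ k) (hH : 1 ≤ H)
    (hJ : J = Nat.log 2 n + 1) (hJH : J ≤ 2 * H)
    (hj₀ : j₀ = Nat.log 2 (n / (8 * k * (20 * H) ^ 2 * J))) (hD : J = j₀ + D) {y : ℝ}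
    (hHy : (H : ℝ) ≤ 2 * y) :
    (D : ℝ) ≤ 19 + Real.logb 2 k + 3 * Real.logb 2 y := by
  have hH' : (1 : ℝ) ≤ H := by exact_mod_cast hH
  have hy : 0 < y := by linarith
  have hk' : (0 : ℝ) < k := by exact_mod_cast hk
  have hP0 : 0 < 8 * k * (20 * H) ^ 2 * J := by subst hJ; positivity
  have hlt : 2 ^ Nat.log 2 n ≤ 8 * k * (20 * H) ^ 2 * J * 2 ^ (j₀ + 1) := by
    refine (Nat.pow_log_le_self 2 (by omega)).trans ?_
    have h := Nat.lt_pow_succ_log_self (b := 2) (by norm_num) (n / (8 * k * (20 * H) ^ 2 * J))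
    rw [← hj₀, Nat.div_lt_iff_lt_mul hP0] at h
    rw [mul_comm]
    exact h.le
  have hPy : (8 * k * (20 * H) ^ 2 * J : ℝ) ≤ 2 ^ 17 * k * y ^ 3 := by
    have hJy : (J : ℝ) ≤ 4 * y := by
      have : (J : ℝ) ≤ 2 * H := by exact_mod_cast hJH
      linarith
    calc (8 * k * (20 * H) ^ 2 * J : ℝ) ≤ 8 * k * (20 * (2 * y)) ^ 2 * (4 * y) := by gcongr
      _ = 51200 * (k * y ^ 3) := by ring
      _ ≤ 2 ^ 17 * (k * y ^ 3) := by gcongr; norm_num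
      _ = _ := by ring
  have hpow : (2 : ℝ) ^ Nat.log 2 n ≤ 2 ^ 17 * k * y ^ 3 * 2 ^ (j₀ + 1) := by
    calc (2 : ℝ) ^ Nat.log 2 n ≤ (8 * k * (20 * H) ^ 2 * J : ℝ) * 2 ^ (j₀ + 1) := by
          exact_mod_cast hlt
      _ ≤ _ := by gcongr
  have hlog := Real.logb_le_logb_of_le (b := 2) (by norm_num) (by positivity) hpow
  rw [Real.logb_mul (by positivity) (by positivity), Real.logb_mul (by positivity) (by positivity),
    Real.logb_mul (by positivity) (by positivity), Real.logb_pow, Real.logb_pow, Real.logb_pow,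
    Real.logb_pow, Real.logb_self_eq_one (by norm_num)] at hlog
  have hDJ : (Nat.log 2 n : ℝ) + 1 = j₀ + D := by
    rw [hJ] at hD
    exact_mod_cast hD
  push_cast at hlog
  linarith

/-- There is a constant `C > 0` such that for all `n ≥ 2`, `2 ≤ k ≤ n`, `δ ∈ (0,1)`,
there is a non-adaptive randomized algorithm (a distribution over pairs of a query
sequence and a decoder) making at most `C·n·log₂(k/δ)·(log₂ k + log₂ log₂ (n/δ))²`
subset queries which, for every partition of an `n`-point set into at most `k`
clusters, outputs exactly that partition (as an unordered partition, i.e. as the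
induced equivalence relation) with probability at least `1 - δ`. -/
theorem nonadaptive_clustering_main :
    ∃ C : ℝ, 0 < C ∧
      ∀ n k : ℕ, 2 ≤ n → 2 ≤ k → k ≤ n →
        ∀ δ : ℝ, 0 < δ → δ < 1 →
          ∃ m : ℕ,
            (m : ℝ) ≤ C * n * Real.logb 2 (k / δ) *
                (Real.logb 2 k + Real.logb 2 (Real.logb 2 (n / δ))) ^ 2 ∧
            ∃ D : PMF ((Fin m → Finset (Fin n)) × ((Fin m → ℕ) → Setoid (Fin n))),
              ∀ c : Fin n → Fin k,
                ENNReal.ofReal (1 - δ) ≤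
                  D.toOuterMeasure
                    {a | a.2 (fun i => clusterCount c (a.1 i)) = Setoid.ker c} := by
  refine ⟨2352, by norm_num, fun n k hn hk hkn δ hδ hδ1 => ?_⟩
  obtain ⟨hlk, hx, hy, hxy⟩ := log_parameters hk hkn hδ hδ1
  have hkH := mul_half_pow_ceil_logb_le (x := k) (by positivity) hδ
  have hnH := mul_half_pow_ceil_logb_le (x := n) (by positivity) hδ
  have hhH : ⌈Real.logb 2 (k / δ)⌉₊ ≤ ⌈Real.logb 2 (n / δ)⌉₊ := Nat.ceil_mono hxy
  have hhx := Nat.ceil_lt_add_one (zero_le_one.trans hx)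
  have hHy := Nat.ceil_lt_add_one (zero_le_one.trans hy)
  have hh1 : 1 ≤ ⌈Real.logb 2 (k / δ)⌉₊ := Nat.one_le_ceil_iff.2 (by linarith)
  set h := ⌈Real.logb 2 (k / δ)⌉₊
  set H := ⌈Real.logb 2 (n / δ)⌉₊
  set x := Real.logb 2 (k / δ)
  set y := Real.logb 2 (n / δ)
  obtain ⟨J, hJ⟩ : ∃ J, J = Nat.log 2 n + 1 := ⟨_, rfl⟩
  obtain ⟨j₀, hj₀⟩ : ∃ j₀, j₀ = Nat.log 2 (n / (8 * k * (20 * H) ^ 2 * J)) := ⟨_, rfl⟩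
  have hlogn : Nat.log 2 n ≤ H := by
    have h1 : 2 ^ Nat.log 2 n ≤ n := Nat.pow_log_le_self 2 (by omega)
    have h2 : (n : ℝ) ≤ 2 ^ H := by
      rw [one_div, inv_pow, ← div_eq_mul_inv, div_le_iff₀ (by positivity)] at hnH
      refine hnH.trans (mul_le_of_le_one_left (by positivity) hδ1.le)
    exact (Nat.pow_le_pow_iff_right (by norm_num)).1 (h1.trans (by exact_mod_cast h2))
  have hlogn' : Nat.log 2 n < n := Nat.log_lt_self 2 (by omega)
  have hjJ : j₀ ≤ J := by
    have : j₀ ≤ Nat.log 2 n := hj₀ ▸ Nat.log_mono_right (Nat.div_le_self _ _)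
    omega
  obtain ⟨D, hD⟩ := Nat.exists_eq_add_of_le hjJ
  have hbound := mul_half_pow_le (j := j₀) (n := n) (by omega) (by omega) hhH hnH
  have hfail : (k : ℝ) ^ 2 * (9 / 10) ^ (28 * h)
      + ((j₀ * (28 * h) : ℕ) * k * (1 / 2) ^ (20 * H)
        + (j₀ * (28 * h) : ℕ) * n * (1 / 2) ^ (20 * H)) ≤ δ := by
    have h1 := sq_mul_pow_le hh1 hδ1 hkH
    have h2 : ((j₀ * (28 * h) : ℕ) : ℝ) * k * (1 / 2) ^ (20 * H)
        ≤ (j₀ * (28 * h) : ℕ) * n * (1 / 2) ^ (20 * H) := by gcongr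
    linarith
  obtain ⟨m, hm, hpmf⟩ := exists_pmf_of_scales (n := n) (D := D) (by omega : 0 < k)
    (by omega : 0 < 20 * H) (by omega) hfail
  refine ⟨m, ?_, hpmf⟩
  have hcount := query_count_le (by omega) hj₀ hjJ (by omega) hm
  have hDle := dense_scales_le (y := y) (by omega) (by omega) (by omega) hJ (by omega) hj₀ hD
    (by linarith)
  have hly : 0 ≤ Real.logb 2 y := Real.logb_nonneg (by norm_num) hy
  set ℓ := Real.logb 2 k + Real.logb 2 y with hℓ
  have hDℓ : (D : ℝ) + 1 ≤ 21 * ℓ ^ 2 := by nlinarith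
  calc (m : ℝ) ≤ ((2 * (28 * h) * n * (D + 1) : ℕ) : ℝ) := by exact_mod_cast hcount
    _ = 2 * (28 * h) * n * (D + 1) := by push_cast; ring
    _ ≤ 2 * (28 * (2 * x)) * n * (21 * ℓ ^ 2) := by gcongr; linarith
    _ = 2352 * n * x * ℓ ^ 2 := by ring
end

section
/- There exists a constant C > 0 such that for every integer n ≥ 4, every integer k with 2 ≤ k ≤ n, every δ ∈ (0,1), and every integer s with 2 ≤ s ≤ √n, there is a non-adaptive randomized algorithm making at most C · (n²/s²) · k · log(n/δ) · log log n subset queries, each query being a subset of size at most s, which, for every partition of an n-point set U into at most k clusters, outputs exactly that partition with probability at least 1 − δ. -/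
open scoped ENNReal

open Finset
section Partitions

theorem clusterCount_congr {U K L : Type*} [DecidableEq K] [DecidableEq L] {c : U → K} {d : U → L}
    {S : Finset U}
    (h : ∀ x ∈ S, ∀ y ∈ S, c x = c y ↔ d x = d y) : clusterCount c S = clusterCount d S := by
  have h₁ : (S.image fun x => (c x, d x)).image Prod.fst = S.image c := by
    rw [image_image]; rfl
  have h₂ : (S.image fun x => (c x, d x)).image Prod.snd = S.image d := by
    rw [image_image]; rfl
  rw [clusterCount, clusterCount, ← h₁, ← h₂, card_image_of_injOn (f := Prod.fst),
    card_image_of_injOn (f := Prod.snd)]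
  all_goals
    intro p hp q hq hpq
    simp only [coe_image, Set.mem_image, mem_coe] at hp hq
    obtain ⟨x, hx, rfl⟩ := hp
    obtain ⟨y, hy, rfl⟩ := hq
    have := h x hx y hy
    simp only [Prod.mk.injEq] at hpq ⊢
    tauto

variable {U K : Type*} [DecidableEq U] [DecidableEq K]

theorem clusterCount_eq_inter_add_sdiff {c : U → K} {R : Finset U}
    (h : ∀ x ∈ R, ∀ y ∉ R, c x ≠ c y) (S : Finset U) :
    clusterCount c S = clusterCount c (S ∩ R) + clusterCount c (S \ R) := by
  have hd : Disjoint ((S ∩ R).image c) ((S \ R).image c) := by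
    simp only [disjoint_left, mem_image, mem_inter, mem_sdiff, not_exists, not_and]
    rintro _ ⟨x, hx, rfl⟩ y hy hxy
    exact h x hx.2 y hy.2 hxy.symm
  rw [clusterCount, clusterCount, clusterCount, ← card_union_of_disjoint hd, ← image_union,
    union_comm, sdiff_union_inter]

/-- If two labelings have the same classes outside `R`, then a query meeting `R` in a pair and
answered identically by both labelings shows that they agree on this pair. -/
theorem eq_iff_eq_of_inter_eq_pair {c d : U → K} {R S : Finset U}
    (hsat : ∀ x ∈ R, ∀ y ∉ R, c x ≠ c y)
    (hR : ∀ x ∉ R, ∀ y, c x = c y ↔ d x = d y)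
    (hS : clusterCount c S = clusterCount d S) {x y : U} (hxy : S ∩ R = {x, y}) :
    c x = c y ↔ d x = d y := by
  have hsat' : ∀ x ∈ R, ∀ y ∉ R, d x ≠ d y := fun x hx y hy hd =>
    hsat x hx y hy ((hR y hy x).2 hd.symm).symm
  have hout : clusterCount c (S \ R) = clusterCount d (S \ R) :=
    clusterCount_congr fun x hx y _ => hR x (mem_sdiff.1 hx).2 y
  rw [clusterCount_eq_inter_add_sdiff hsat, clusterCount_eq_inter_add_sdiff hsat', hout, hxy] at hS
  have hS' := Nat.add_right_cancel hS
  simp only [clusterCount, image_insert, image_singleton] at hS'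
  by_cases h₁ : c x = c y <;> by_cases h₂ : d x = d y
  · tauto
  · rw [h₁, pair_eq_singleton, card_singleton, card_pair h₂] at hS'
    omega
  · rw [h₂, pair_eq_singleton, card_singleton, card_pair h₁] at hS'
    omega
  · tauto

/-- If two labelings have the same classes outside `R`, then they have the same class `A ⊆ R`
provided they agree on sufficiently many pairs meeting `A`. -/
theorem class_eq_of_pairs {c d : U → K} {R A : Finset U}
    (hsat : ∀ x ∈ R, ∀ y ∉ R, c x ≠ c y)
    (hR : ∀ x ∉ R, ∀ y, c x = c y ↔ d x = d y) {a : U} (ha : a ∈ R)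
    (hA : ∀ y, y ∈ A ↔ c a = c y)
    (h : ∀ X ⊆ R, X.Nonempty → #A ≤ 2 * #(A \ X) →
      ∃ x ∈ X, ∃ y ∈ A \ X, (c x = c y ↔ d x = d y)) (y : U) :
    c a = c y ↔ d a = d y := by
  have hAR : ∀ z ∈ A, z ∈ R := fun z hz => by
    by_contra hz'
    exact hsat a ha z hz' ((hA z).1 hz)
  have hconst : ∀ z, c a = c z → d a = d z := by
    intro b hb
    by_contra hne
    have hcard := card_filter_add_card_filter_not (s := A) (fun z => d a = d z)
    have h₁ : A \ {z ∈ A | d a = d z} = {z ∈ A | ¬ d a = d z} := by ext z; simp; tauto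
    have h₂ : A \ {z ∈ A | ¬ d a = d z} = {z ∈ A | d a = d z} := by ext z; simp; tauto
    rcases le_total #{z ∈ A | d a = d z} #{z ∈ A | ¬ d a = d z} with hle | hle
    · obtain ⟨x, hx, z, hz, hxz⟩ := h {z ∈ A | d a = d z}
        (fun z hz => hAR z (mem_filter.1 hz).1) ⟨a, by simp [hA]⟩ (by rw [h₁]; omega)
      rw [h₁] at hz
      simp only [hA, mem_filter] at hx hz
      exact hz.2 (hx.2.trans (hxz.1 (hx.1.symm.trans hz.1)))
    · obtain ⟨x, hx, z, hz, hxz⟩ := h {z ∈ A | ¬ d a = d z}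
        (fun z hz => hAR z (mem_filter.1 hz).1) ⟨b, by simp [hA, hb, hne]⟩ (by rw [h₂]; omega)
      rw [h₂] at hz
      simp only [hA, mem_filter] at hx hz
      exact hx.2 (hz.2.trans (hxz.1 (hx.1.symm.trans hz.1)).symm)
  refine ⟨hconst y, fun hd => ?_⟩
  by_contra hne
  by_cases hy : y ∈ R
  · have hAy : A \ {y} = A := sdiff_eq_self_of_disjoint (by simpa [hA] using hne)
    obtain ⟨x, hx, z, hz, hxz⟩ := h {y} (by simpa using hy) (singleton_nonempty y)
      (by rw [hAy]; omega)
    rw [hAy, hA] at hz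
    rw [mem_singleton] at hx
    subst hx
    exact hne (hz.trans (hxz.2 (hd.symm.trans (hconst z hz))).symm)
  · exact hne ((hR y hy a).2 hd.symm).symm

end Partitions

section Sampling

theorem add_two_pow_le (u : ℕ) : ((u : ℝ) + 2) ^ u ≤ 8 * (u : ℝ) ^ u := by
  rcases Nat.eq_zero_or_pos u with rfl | hu
  · norm_num
  have hu' : (0 : ℝ) < u := by exact_mod_cast hu
  have h₁ : (1 + 2 / (u : ℝ)) ^ u ≤ 8 := by
    calc (1 + 2 / (u : ℝ)) ^ u ≤ (Real.exp (2 / u)) ^ u := by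
          gcongr
          linarith [Real.add_one_le_exp (2 / (u : ℝ))]
      _ = Real.exp 1 ^ 2 := by
          rw [← Real.exp_nat_mul, ← Real.exp_nat_mul]
          congr 1
          field_simp
          norm_num
      _ ≤ 8 := by nlinarith [Real.exp_one_lt_d9, Real.exp_pos 1]
  calc ((u : ℝ) + 2) ^ u = (1 + 2 / (u : ℝ)) ^ u * (u : ℝ) ^ u := by
        rw [← mul_pow]; congr 1; field_simp
    _ ≤ 8 * (u : ℝ) ^ u := by gcongr

variable {ι α : Type*} [Fintype ι] [DecidableEq ι] [Fintype α] [DecidableEq α]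

/-- The number of functions hitting `R` on `T` in exactly one point of `X` and one of `Y`. -/
theorem card_offDiag_mul_le_card_image_inter_eq_pair (T : Finset ι) {R X Y : Finset α}
    (hX : X ⊆ R) (hY : Y ⊆ R) (hXY : Disjoint X Y) :
    #T.offDiag * (#X * #Y) * (#Rᶜ ^ (#T - 2) * Fintype.card α ^ (Fintype.card ι - #T)) ≤
      #{f : ι → α | ∃ x ∈ X, ∃ y ∈ Y, T.image f ∩ R = {x, y}} := by
  let box : (ι × ι) × (α × α) → Finset (ι → α) := fun p => Fintype.piFinset fun l =>
    if l = p.1.1 then {p.2.1} else if l = p.1.2 then {p.2.2} else if l ∈ T then Rᶜ else univ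
  have hbox : ∀ p f, f ∈ box p → p.1.1 ≠ p.1.2 →
      f p.1.1 = p.2.1 ∧ f p.1.2 = p.2.2 ∧
        ∀ l ∈ T, l ≠ p.1.1 → l ≠ p.1.2 → f l ∉ R := by
    intro p f hf hne
    simp only [box, Fintype.mem_piFinset] at hf
    refine ⟨by simpa using hf p.1.1, by simpa [hne.symm] using hf p.1.2, fun l hl h₁ h₂ => ?_⟩
    simpa [hl, h₁, h₂] using hf l
  have hcard : ∀ p ∈ T.offDiag ×ˢ (X ×ˢ Y),
      #(box p) = #Rᶜ ^ (#T - 2) * Fintype.card α ^ (Fintype.card ι - #T) := by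
    rintro ⟨⟨i, j⟩, ⟨x, y⟩⟩ hp
    simp only [mem_product, mem_offDiag] at hp
    obtain ⟨⟨hi, hj, hij⟩, hx, hy⟩ := hp
    have hj' : j ∈ T.erase i := by simp [hj, hij.symm]
    simp only [box, Fintype.card_piFinset]
    rw [← prod_mul_prod_compl T, ← mul_prod_erase T _ hi, ← mul_prod_erase _ _ hj']
    have h₁ : ∀ l ∈ (T.erase i).erase j,
        #(if l = i then {x} else if l = j then {y} else if l ∈ T then Rᶜ else univ) = #Rᶜ := by
      intro l hl
      simp only [mem_erase] at hl
      simp [hl.1, hl.2.1, hl.2.2]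
    have h₂ : ∀ l ∈ Tᶜ,
        #(if l = i then {x} else if l = j then {y} else if l ∈ T then Rᶜ else univ)
          = Fintype.card α := by
      intro l hl
      rw [mem_compl] at hl
      have hli : l ≠ i := by rintro rfl; exact hl hi
      have hlj : l ≠ j := by rintro rfl; exact hl hj
      simp [hl, hli, hlj]
    rw [prod_congr rfl h₁, prod_congr rfl h₂, prod_const, prod_const, card_erase_of_mem hj',
      card_erase_of_mem hi, card_compl]
    simp [hij.symm, Nat.sub_sub, card_compl]
  have hdisj : Set.PairwiseDisjoint ↑(T.offDiag ×ˢ (X ×ˢ Y)) box := by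
    rintro ⟨⟨i, j⟩, ⟨x, y⟩⟩ hp ⟨⟨i', j'⟩, ⟨x', y'⟩⟩ hp' hne
    simp only [coe_product, Set.mem_prod, mem_coe, mem_offDiag] at hp hp'
    obtain ⟨⟨hi, hj, hij⟩, hx, hy⟩ := hp
    obtain ⟨⟨hi', hj', hij'⟩, hx', hy'⟩ := hp'
    refine disjoint_left.2 fun f hf hf' => hne ?_
    obtain ⟨h₁, h₂, -⟩ := hbox _ f hf hij
    obtain ⟨h₁', h₂', h₃'⟩ := hbox _ f hf' hij'
    dsimp only at h₁ h₂ h₁' h₂' h₃'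
    have hii : i = i' := by
      by_contra hii
      by_cases hij'' : i = j'
      · subst hij''
        exact disjoint_left.1 hXY hx (h₁ ▸ h₂' ▸ hy')
      · exact h₃' i hi hii hij'' (h₁ ▸ hX hx)
    have hjj : j = j' := by
      by_contra hjj
      by_cases hji : j = i'
      · exact hij (hii.trans hji.symm)
      · exact h₃' j hj hji hjj (h₂ ▸ hY hy)
    subst hii hjj
    rw [← h₁, ← h₂, ← h₁', ← h₂']
  rw [← card_product, ← card_product, ← smul_eq_mul, ← sum_const, ← sum_congr rfl hcard,
    ← card_biUnion hdisj]
  refine card_le_card fun f hf => ?_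
  simp only [mem_biUnion] at hf
  obtain ⟨⟨⟨i, j⟩, ⟨x, y⟩⟩, hp, hf⟩ := hf
  simp only [mem_product, mem_offDiag] at hp
  obtain ⟨⟨hi, hj, hij⟩, hx, hy⟩ := hp
  obtain ⟨h₁, h₂, h₃⟩ := hbox _ f hf hij
  dsimp only at h₁ h₂ h₃
  simp only [mem_filter, mem_univ, true_and]
  refine ⟨x, hx, y, hy, ?_⟩
  ext z
  simp only [mem_inter, mem_image, mem_insert, mem_singleton]
  constructor
  · rintro ⟨⟨l, hl, rfl⟩, hz⟩
    by_cases hli : l = i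
    · exact Or.inl (hli ▸ h₁)
    · by_cases hlj : l = j
      · exact Or.inr (hlj ▸ h₂)
      · exact absurd hz (h₃ l hl hli hlj)
  · rintro (rfl | rfl)
    · exact ⟨⟨i, hi, h₁⟩, hX hx⟩
    · exact ⟨⟨j, hj, h₂⟩, hY hy⟩

theorem mul_card_pow_le_card_image_inter_eq_pair {T : Finset ι} (hT : 2 ≤ #T)
    {R X Y : Finset α} (hR : #T * #R ≤ 2 * Fintype.card α)
    (hX : X ⊆ R) (hY : Y ⊆ R) (hXY : Disjoint X Y) :
    (#T : ℝ) ^ 2 * #X * #Y / (16 * (Fintype.card α : ℝ) ^ 2) * (Fintype.card (ι → α) : ℝ) ≤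
      #{f : ι → α | ∃ x ∈ X, ∃ y ∈ Y, T.image f ∩ R = {x, y}} := by
  refine le_trans ?_
    (Nat.cast_le.2 (card_offDiag_mul_le_card_image_inter_eq_pair T hX hY hXY))
  rcases (Fintype.card α).eq_zero_or_pos with h0 | hpos
  · rw [h0]
    norm_num
    positivity
  obtain ⟨u, hu⟩ := Nat.exists_eq_add_of_le' hT
  obtain ⟨v, hv⟩ := Nat.exists_eq_add_of_le (card_le_univ T)
  have hRc : (#Rᶜ : ℝ) + #R = Fintype.card α := by exact_mod_cast card_compl_add_card R
  rw [Fintype.card_fun, hv, Nat.add_sub_cancel_left, offDiag_card, hu, Nat.add_sub_cancel]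
  set n := Fintype.card α
  have hn : (0 : ℝ) < n := by exact_mod_cast hpos
  have hsq : (u + 2) * (u + 2) - (u + 2) = (u + 2) * (u + 1) := by
    rw [Nat.sub_eq_iff_eq_add (by nlinarith)]; ring
  rw [hsq]
  push_cast
  have hRn : ((u : ℝ) + 2) * #R ≤ 2 * n := by
    rw [hu] at hR; exact_mod_cast hR
  have hkey : (n : ℝ) ^ u ≤ 8 * (#Rᶜ : ℝ) ^ u := by
    have h₁ : (u : ℝ) * n ≤ (u + 2) * #Rᶜ := by nlinarith
    have h₂ : ((u : ℝ) * n) ^ u ≤ ((u + 2) * #Rᶜ) ^ u := by gcongr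
    rw [mul_pow, mul_pow] at h₂
    have h₃ := add_two_pow_le u
    have h₄ : (0 : ℝ) < (u : ℝ) ^ u := by
      rcases Nat.eq_zero_or_pos u with rfl | h
      · norm_num
      · positivity
    have h₅ : (u : ℝ) ^ u * (n : ℝ) ^ u ≤ (u : ℝ) ^ u * (8 * (#Rᶜ : ℝ) ^ u) := by
      refine h₂.trans ?_
      nlinarith [mul_le_mul_of_nonneg_right h₃ (by positivity : (0 : ℝ) ≤ (#Rᶜ : ℝ) ^ u)]
    exact le_of_mul_le_mul_left h₅ h₄
  have heq : ((u : ℝ) + 2) ^ 2 * #X * #Y / (16 * (n : ℝ) ^ 2) * (n : ℝ) ^ (u + 2 + v) =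
      ((u : ℝ) + 2) * #X * #Y * (n : ℝ) ^ v * (((u : ℝ) + 2) / 16 * (n : ℝ) ^ u) := by
    rw [pow_add, pow_add]; field_simp
  rw [heq]
  have hle : ((u : ℝ) + 2) / 16 * (n : ℝ) ^ u ≤ ((u : ℝ) + 1) * (#Rᶜ : ℝ) ^ u := by
    calc ((u : ℝ) + 2) / 16 * (n : ℝ) ^ u ≤ ((u : ℝ) + 2) / 16 * (8 * (#Rᶜ : ℝ) ^ u) := by gcongr
      _ = ((u : ℝ) + 2) / 2 * (#Rᶜ : ℝ) ^ u := by ring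
      _ ≤ ((u : ℝ) + 1) * (#Rᶜ : ℝ) ^ u := by
        gcongr
        linarith [(Nat.cast_nonneg u : (0 : ℝ) ≤ u)]
  calc _ ≤ ((u : ℝ) + 2) * #X * #Y * (n : ℝ) ^ v * (((u : ℝ) + 1) * (#Rᶜ : ℝ) ^ u) := by gcongr
    _ = _ := by ring

theorem card_forall_notMem_le (P : Finset ι) {H : Finset α} {q : ℝ}
    (hq : q * Fintype.card α ≤ #H) :
    (#{ω : ι → α | ∀ j ∈ P, ω j ∉ H} : ℝ) ≤ Real.exp (-q) ^ #P * Fintype.card (ι → α) := by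
  have hset : ({ω : ι → α | ∀ j ∈ P, ω j ∉ H} : Finset (ι → α)) =
      Fintype.piFinset fun j => if j ∈ P then Hᶜ else univ := by
    ext ω
    simp only [mem_filter, mem_univ, true_and, Fintype.mem_piFinset]
    refine forall_congr' fun j => ?_
    by_cases hj : j ∈ P <;> simp [hj]
  have h₁ : (#Hᶜ : ℝ) ≤ Real.exp (-q) * Fintype.card α := by
    have hc : (#Hᶜ : ℝ) + #H = Fintype.card α := by exact_mod_cast card_compl_add_card H
    nlinarith [Real.add_one_le_exp (-q), (Nat.cast_nonneg _ : (0 : ℝ) ≤ Fintype.card α)]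
  rw [hset, Fintype.card_piFinset, ← prod_mul_prod_compl P,
    prod_congr rfl (fun j hj => by rw [if_pos hj] : ∀ j ∈ P, _ = #Hᶜ),
    prod_congr rfl (fun j hj => by rw [if_neg (mem_compl.1 hj), card_univ] :
      ∀ j ∈ Pᶜ, _ = Fintype.card α), prod_const, prod_const, Fintype.card_fun,
    ← card_add_card_compl P, pow_add]
  push_cast
  rw [← mul_assoc, ← mul_pow]
  gcongr

end Sampling

section Stages

/-- Two labelings have the same classes if they agree on enough pairs at each stage, where stage `i`
settles the classes contained in `R i` but not in `R (i + 1)`, and stage `N` all those left. -/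
theorem eq_iff_eq_of_stages {U K : Type*} [Fintype U] [DecidableEq U] [DecidableEq K] {c d : U → K}
    {R : ℕ → Finset U} {N : ℕ} (hR0 : R 0 = univ)
    (hsat : ∀ i, ∀ x ∈ R i, ∀ y ∉ R i, c x ≠ c y)
    (h : ∀ i ≤ N, ∀ a ∈ R i, (i < N → a ∉ R (i + 1)) → ∀ X ⊆ R i, X.Nonempty →
      #(univ.filter (c a = c ·)) ≤ 2 * #(univ.filter (c a = c ·) \ X) →
      ∃ S, clusterCount c S = clusterCount d S ∧
        ∃ x ∈ X, ∃ y ∈ univ.filter (c a = c ·) \ X, S ∩ R i = {x, y})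
    (x y : U) : c x = c y ↔ d x = d y := by
  have step : ∀ i ≤ N, (∀ x ∉ R i, ∀ y, c x = c y ↔ d x = d y) →
      ∀ a, (i < N → a ∉ R (i + 1)) → ∀ y, c a = c y ↔ d a = d y := by
    intro i hi hR a ha y
    by_cases hai : a ∈ R i
    · refine class_eq_of_pairs (hsat i) hR hai (A := univ.filter (c a = c ·)) (by simp)
        (fun X hX hne hcard => ?_) y
      obtain ⟨S, hS, x, hx, z, hz, hxz⟩ := h i hi a hai ha X hX hne hcard
      exact ⟨x, hx, z, hz, eq_iff_eq_of_inter_eq_pair (hsat i) hR hS hxz⟩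
    · exact hR a hai y
  have hind : ∀ i ≤ N, ∀ x ∉ R i, ∀ y, c x = c y ↔ d x = d y := by
    intro i
    induction i with
    | zero => simp [hR0]
    | succ i ih => exact fun hi x hx => step i (by omega) (ih (by omega)) x fun _ => hx
  exact step N le_rfl (hind N le_rfl) x (fun h => absurd h (lt_irrefl N)) y

theorem exists_doubly_exponential_schedule {n s : ℕ} (hn : 4 ≤ n) (hs : 2 ≤ s)
    (hsn : s ^ 2 ≤ n) :
    ∃ (N : ℕ) (t : ℕ → ℕ), t 0 = 2 ∧ t N = s ∧
      (∀ i, 2 ≤ t i ∧ t i ≤ s ∧ t (i + 1) ≤ t i ^ 2) ∧ N + 1 ≤ n ∧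
      ((N + 1 : ℕ) : ℝ) ≤ 2 * Real.logb 2 (Real.logb 2 n) := by
  have hex : ∃ N, s ≤ 2 ^ 2 ^ N :=
    ⟨s, (Nat.lt_two_pow_self.trans (Nat.pow_lt_pow_right one_lt_two Nat.lt_two_pow_self)).le⟩
  have hlog4 : (2 : ℝ) ≤ Real.logb 2 n := by
    rw [Real.le_logb_iff_rpow_le one_lt_two (by positivity)]
    norm_num
    exact_mod_cast hn
  have hloglog : (1 : ℝ) ≤ Real.logb 2 (Real.logb 2 n) := by
    rw [Real.le_logb_iff_rpow_le one_lt_two (by positivity)]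
    simpa using hlog4
  have hpow : ∀ i : ℕ, 2 ≤ 2 ^ 2 ^ i := fun i => by
    calc 2 = 2 ^ 1 := rfl
      _ ≤ 2 ^ 2 ^ i := Nat.pow_le_pow_right two_pos Nat.one_le_two_pow
  have hN : Nat.find hex ≤ Real.logb 2 (Real.logb 2 n) := by
    rcases (Nat.find hex).eq_zero_or_eq_succ_pred with h0 | hsucc
    · rw [h0, Nat.cast_zero]
      linarith
    · have hlt : 2 ^ 2 ^ (Nat.find hex - 1) < s :=
        not_le.1 (Nat.find_min hex (by omega))
      have hle : 2 ^ 2 ^ Nat.find hex ≤ n := by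
        calc 2 ^ 2 ^ Nat.find hex = (2 ^ 2 ^ (Nat.find hex - 1)) ^ 2 := by
              rw [← pow_mul, ← pow_succ]
              congr 2
          _ ≤ s ^ 2 := Nat.pow_le_pow_left hlt.le 2
          _ ≤ n := hsn
      rw [Real.le_logb_iff_rpow_le one_lt_two (by positivity),
        Real.le_logb_iff_rpow_le one_lt_two (by positivity)]
      rw [Real.rpow_natCast]
      have : ((2 : ℝ) ^ Nat.find hex) = ((2 ^ Nat.find hex : ℕ) : ℝ) := by push_cast; rfl
      rw [this, Real.rpow_natCast]
      exact_mod_cast hle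
  refine ⟨Nat.find hex, fun i => min (2 ^ 2 ^ i) s, by simpa using hs,
    min_eq_right (Nat.find_spec hex), fun i => ⟨le_min (hpow i) hs, min_le_right _ _, ?_⟩, ?_, ?_⟩
  · beta_reduce
    rcases le_total (2 ^ 2 ^ i) s with h | h
    · rw [min_eq_left h, ← pow_mul, ← pow_succ]
      exact min_le_left _ _
    · rw [min_eq_right h]
      exact (min_le_right _ _).trans (Nat.le_self_pow two_ne_zero s)
  · have : Nat.find hex ≤ s := Nat.find_min' hex
      (Nat.lt_two_pow_self.trans (Nat.pow_lt_pow_right one_lt_two Nat.lt_two_pow_self)).le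
    nlinarith
  · push_cast
    linarith

theorem card_mul_le_of_forall_card_class {U : Type*} [Fintype U] [DecidableEq U] {k t b : ℕ}
    (hk : 0 < k) (c : U → Fin k) {R : Finset U}
    (hR : ∀ x ∈ R, #(univ.filter (c x = c ·)) * k * t ≤ b) : t * #R ≤ b := by
  have h : k * (t * #R) ≤ k * b := by
    calc k * (t * #R) = ∑ i ∈ R.image c, #{x ∈ R | c x = i} * k * t := by
          rw [← sum_mul, ← sum_mul, ← card_eq_sum_card_image]; ring
      _ ≤ ∑ i ∈ R.image c, b := by
          refine sum_le_sum fun i hi => ?_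
          obtain ⟨x, hx, rfl⟩ := mem_image.1 hi
          refine le_trans ?_ (hR x hx)
          gcongr
          exact fun y hy => by simpa using (mem_filter.1 hy).2.symm
      _ ≤ k * b := by
          rw [sum_const, smul_eq_mul]
          gcongr
          exact (card_le_univ _).trans (Fintype.card_fin k).le
  exact le_of_mul_le_mul_left h hk

theorem card_exists_nonempty_le {Ω I U : Type*} [Fintype Ω] [DecidableEq Ω] [Fintype I] [Fintype U]
    {B : I → Finset U → Finset Ω} {ε b : ℝ}
    (hB : ∀ i X, X.Nonempty → (#(B i X) : ℝ) ≤ ε ^ #X * b) :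
    (#{ω | ∃ i X, X.Nonempty ∧ ω ∈ B i X} : ℝ) ≤
      Fintype.card I * (((1 + ε) ^ Fintype.card U - 1) * b) := by
  classical
  have hsub : ({ω | ∃ i X, X.Nonempty ∧ ω ∈ B i X} : Finset Ω) ⊆
      univ.biUnion fun i => (univ.erase ∅).biUnion (B i) := by
    intro ω hω
    obtain ⟨i, X, hX, hω⟩ := (mem_filter.1 hω).2
    simp only [mem_biUnion, mem_univ, true_and, mem_erase, and_true]
    exact ⟨i, X, hX.ne_empty, hω⟩
  have hsum : ∑ X ∈ univ.erase (∅ : Finset U), ε ^ #X = (1 + ε) ^ Fintype.card U - 1 := by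
    have h := sum_pow_mul_eq_add_pow ε 1 (univ : Finset U)
    simp only [one_pow, mul_one, powerset_univ, card_univ] at h
    rw [← add_sum_erase _ _ (mem_univ ∅)] at h
    rw [add_comm 1 ε, ← h]
    simp
  calc (#{ω | ∃ i X, X.Nonempty ∧ ω ∈ B i X} : ℝ)
      ≤ ∑ i : I, ∑ X ∈ univ.erase (∅ : Finset U), (#(B i X) : ℝ) := by
        refine (Nat.cast_le.2 ((card_le_card hsub).trans (card_biUnion_le.trans
          (sum_le_sum fun i _ => card_biUnion_le)))).trans ?_
        push_cast
        rfl
    _ ≤ ∑ i : I, ∑ X ∈ univ.erase (∅ : Finset U), ε ^ #X * b := by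
        refine sum_le_sum fun i _ => sum_le_sum fun X hX => hB i X ?_
        exact nonempty_iff_ne_empty.2 (mem_erase.1 hX).1
    _ = _ := by
        rw [sum_const, ← sum_mul, hsum, card_univ, nsmul_eq_mul]

end Stages

section Algorithm

variable {n k s N m : ℕ}

/-- Sequences of `m` samples of size `s` for each of the stages `0, …, N`. -/
abbrev StageSamples (n s N m : ℕ) : Type :=
  Fin (N + 1) × Fin m → Fin s → Fin n

/-- The query of stage `i` given by the samples `f`, of which it uses the first `t i`. -/
def stageQuery (t : ℕ → ℕ) (i : ℕ) (f : Fin s → Fin n) : Finset (Fin n) :=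
  (univ.filter fun l : Fin s => (l : ℕ) < t i).image f

theorem card_stageQuery_le (t : ℕ → ℕ) (i : ℕ) (f : Fin s → Fin n) :
    #(stageQuery t i f) ≤ s :=
  card_image_le.trans ((card_le_univ _).trans (Fintype.card_fin s).le)

theorem one_add_pow_sub_one_le {ε : ℝ} (hε : 0 ≤ ε) (h : n * ε ≤ 1) :
    (1 + ε) ^ n - 1 ≤ 2 * (n * ε) := by
  have h₁ : (1 + ε) ^ n ≤ Real.exp (n * ε) := by
    rw [Real.exp_nat_mul]
    gcongr
    linarith [Real.add_one_le_exp ε]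
  have h₂ := Real.abs_exp_sub_one_le (x := n * ε) (by rwa [abs_of_nonneg (by positivity)])
  rw [abs_of_nonneg (by positivity : (0 : ℝ) ≤ n * ε)] at h₂
  linarith [le_abs_self (Real.exp (n * ε) - 1)]

theorem sample_budget_of_le {n s k m t a Λ : ℝ} (hn : 0 < n) (hs : 0 < s) (hk : 0 ≤ k)
    (ha : 0 ≤ a) (hΛ : 0 ≤ Λ) (hm : 128 * (n ^ 2 / s ^ 2) * k * Λ ≤ m) (hsn : s ^ 2 ≤ n)
    (h : 2 * n ≤ a * k * t ^ 2) : 128 * n ^ 2 * Λ ≤ m * (t ^ 2 * a) := by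
  have hns : n ≤ n ^ 2 / s ^ 2 := by
    rw [le_div_iff₀ (by positivity)]
    nlinarith
  calc 128 * n ^ 2 * Λ ≤ 128 * n * Λ * (2 * n) := by nlinarith [mul_nonneg (pow_pos hn 2).le hΛ]
    _ ≤ 128 * n * Λ * (a * k * t ^ 2) := by gcongr
    _ = 128 * n * k * Λ * (t ^ 2 * a) := by ring
    _ ≤ 128 * (n ^ 2 / s ^ 2) * k * Λ * (t ^ 2 * a) := by gcongr
    _ ≤ m * (t ^ 2 * a) := by gcongr

theorem sample_budget_of_one_le {n s k m a Λ : ℝ} (hs : 0 < s) (hk : 1 ≤ k)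
    (ha : 1 ≤ a) (hΛ : 0 ≤ Λ) (hm : 128 * (n ^ 2 / s ^ 2) * k * Λ ≤ m) :
    128 * n ^ 2 * Λ ≤ m * (s ^ 2 * a) := by
  calc 128 * n ^ 2 * Λ = 128 * (n ^ 2 / s ^ 2) * 1 * Λ * (s ^ 2 * 1) := by field_simp
    _ ≤ 128 * (n ^ 2 / s ^ 2) * k * Λ * (s ^ 2 * a) := by gcongr
    _ ≤ m * (s ^ 2 * a) := by gcongr

theorem exp_neg_pow_le_of_sample_budget {n δ t a b : ℝ} {m u : ℕ} (hn : 0 < n) (hδ : 0 < δ)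
    (h : 128 * n ^ 2 * Real.log (n / δ) ≤ m * (t ^ 2 * a)) (hab : a ≤ 2 * b) :
    Real.exp (-(t ^ 2 * u * b / (16 * n ^ 2))) ^ m ≤ ((δ / n) ^ 4) ^ u := by
  have hle : Real.log (((δ / n) ^ 4) ^ u) = -(4 * u * Real.log (n / δ)) := by
    rw [Real.log_pow, Real.log_pow, ← inv_div, Real.log_inv]
    push_cast
    ring
  rw [← Real.exp_nat_mul, ← Real.exp_log (by positivity : 0 < ((δ / n) ^ 4) ^ u), hle,
    Real.exp_le_exp]
  have h' : 4 * u * Real.log (n / δ) ≤ m * (t ^ 2 * u * b / (16 * n ^ 2)) := by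
    rw [mul_div_assoc', le_div_iff₀ (by positivity)]
    calc 4 * u * Real.log (n / δ) * (16 * n ^ 2) = u * (128 * n ^ 2 * Real.log (n / δ)) / 2 := by
          ring
      _ ≤ u * (m * (t ^ 2 * a)) / 2 := by gcongr
      _ ≤ u * (m * (t ^ 2 * (2 * b))) / 2 := by gcongr
      _ = _ := by ring
  linarith

theorem union_bound_le {n N : ℕ} (hn : 4 ≤ n) (hN : N + 1 ≤ n) {δ : ℝ} (hδ : 0 < δ)
    (hδ1 : δ < 1) : ((N : ℝ) + 1) * n * ((1 + (δ / n) ^ 4) ^ n - 1) ≤ δ := by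
  have hn4 : (4 : ℝ) ≤ n := by exact_mod_cast hn
  have hN' : (N : ℝ) + 1 ≤ n := by exact_mod_cast hN
  have hδ4 : δ ^ 4 ≤ δ := by
    simpa using pow_le_pow_of_le_one hδ.le hδ1.le (by norm_num : 1 ≤ 4)
  have hle1 : n * (δ / n) ^ 4 ≤ 1 := by
    calc n * (δ / n) ^ 4 = δ ^ 4 / (n : ℝ) ^ 3 := by field_simp
      _ ≤ 1 := by
        rw [div_le_one (by positivity)]
        have := one_le_pow₀ (by linarith : (1 : ℝ) ≤ n) (n := 3)
        linarith
  calc ((N : ℝ) + 1) * n * ((1 + (δ / n) ^ 4) ^ n - 1)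
      ≤ ((N : ℝ) + 1) * n * (2 * (n * (δ / n) ^ 4)) := by
        gcongr
        exact one_add_pow_sub_one_le (by positivity) hle1
    _ ≤ (n : ℝ) * n * (2 * (n * (δ / n) ^ 4)) := by gcongr
    _ = 2 * δ ^ 4 / n := by field_simp
    _ ≤ δ := by
      rw [div_le_iff₀ (by positivity)]
      nlinarith

open Classical in
theorem card_ambiguous_samples_le (hn : 4 ≤ n) (hk : 2 ≤ k) (hsn : s ^ 2 ≤ n) {t : ℕ → ℕ}
    (ht0 : t 0 = 2) (htN : t N = s) (ht : ∀ i, 2 ≤ t i ∧ t i ≤ s ∧ t (i + 1) ≤ t i ^ 2)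
    (hN : N + 1 ≤ n) {δ : ℝ} (hδ : 0 < δ) (hδ1 : δ < 1)
    (hm : 128 * ((n : ℝ) ^ 2 / (s : ℝ) ^ 2) * k * Real.log (n / δ) ≤ m) (c : Fin n → Fin k) :
    (#{ω : StageSamples n s N m | ∃ d : Fin n → Fin k,
        (∀ j, clusterCount c (stageQuery t j.1 (ω j)) = clusterCount d (stageQuery t j.1 (ω j))) ∧
          Setoid.ker d ≠ Setoid.ker c} : ℝ) ≤
      δ * Fintype.card (StageSamples n s N m) := by
  let A : Fin n → Finset (Fin n) := fun a => univ.filter (c a = c ·)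
  let R : ℕ → Finset (Fin n) := fun i => {x | i = 0 ∨ #(A x) * k * t i < 2 * n}
  let T : ℕ → Finset (Fin s) := fun i => univ.filter fun l : Fin s => (l : ℕ) < t i
  let valid : ℕ → Fin n → Finset (Fin n) → Prop := fun i a X =>
    a ∈ R i ∧ (i < N → a ∉ R (i + 1)) ∧ X ⊆ R i ∧ #(A a) ≤ 2 * #(A a \ X)
  let H : ℕ → Fin n → Finset (Fin n) → Finset (Fin s → Fin n) := fun i a X =>
    {f | ∃ x ∈ X, ∃ y ∈ A a \ X, (T i).image f ∩ R i = {x, y}}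
  let B : Fin (N + 1) × Fin n → Finset (Fin n) → Finset (StageSamples n s N m) := fun p X =>
    univ.filter fun ω => valid p.1 p.2 X ∧
      ∀ j ∈ ({p.1} : Finset (Fin (N + 1))) ×ˢ (univ : Finset (Fin m)), ω j ∉ H p.1 p.2 X
  have hAc : ∀ {x y}, c x = c y → A x = A y := fun h => by simp only [A, h]
  have hsat : ∀ i, ∀ x ∈ R i, ∀ y ∉ R i, c x ≠ c y := by
    intro i x hx y hy hxy
    simp only [R, mem_filter, mem_univ, true_and] at hx hy
    rw [hAc hxy] at hx
    exact hy hx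
  have hcardT : ∀ i, #(T i) = t i := by
    intro i
    rw [Fin.card_filter_val_lt]
    exact min_eq_right (ht i).2.1
  have hcardR : ∀ i, t i * #(R i) ≤ 2 * n := by
    intro i
    rcases Nat.eq_zero_or_pos i with rfl | hi
    · rw [ht0]
      gcongr
      exact (card_le_univ _).trans (Fintype.card_fin n).le
    · refine card_mul_le_of_forall_card_class (by omega : 0 < k) c fun x hx => ?_
      simp only [R, mem_filter, mem_univ, true_and] at hx
      exact (hx.resolve_left hi.ne').le
  have hn0 : (0 : ℝ) < n := by positivity
  have hlog : 0 < Real.log (n / δ) := by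
    refine Real.log_pos ((one_lt_div hδ).2 ?_)
    have : (4 : ℝ) ≤ n := by exact_mod_cast hn
    linarith
  have hs0 : (0 : ℝ) < s := by
    have := (ht 0).1.trans (ht 0).2.1
    positivity
  have hmain : ∀ i ≤ N, ∀ a X, valid i a X →
      128 * (n : ℝ) ^ 2 * Real.log (n / δ) ≤ m * ((t i : ℝ) ^ 2 * #(A a)) := by
    rintro i hi a X ⟨ha, ha', -, -⟩
    rcases hi.lt_or_eq with hi | rfl
    · have h₁ : 2 * n ≤ #(A a) * k * t (i + 1) := by
        have := ha' hi
        simp only [R, mem_filter, mem_univ, true_and] at this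
        push Not at this
        exact this.2
      have h₂ : 2 * n ≤ #(A a) * k * t i ^ 2 :=
        h₁.trans (Nat.mul_le_mul_left _ (ht i).2.2)
      exact sample_budget_of_le hn0 hs0 (Nat.cast_nonneg k) (Nat.cast_nonneg _) hlog.le hm
        (by exact_mod_cast hsn) (by exact_mod_cast h₂)
    · have h₁ : 1 ≤ #(A a) := card_pos.2 ⟨a, by simp [A]⟩
      rw [htN]
      exact sample_budget_of_one_le hs0 (by exact_mod_cast (by omega : 1 ≤ k))
        (by exact_mod_cast h₁) hlog.le hm
  have hB : ∀ p X, X.Nonempty → (#(B p X) : ℝ) ≤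
      ((δ / n) ^ 4) ^ #X * Fintype.card (StageSamples n s N m) := by
    rintro ⟨i, a⟩ X -
    by_cases hv : valid i a X
    · have hAR : A a ⊆ R i := by
        intro z hz
        by_contra hz'
        exact hsat i a hv.1 z hz' (by simpa [A] using hz)
      have hq := mul_card_pow_le_card_image_inter_eq_pair (T := T i)
        (by rw [hcardT]; exact (ht i).1)
        (R := R i) (X := X) (Y := A a \ X) (by rw [hcardT, Fintype.card_fin]; exact hcardR i)
        hv.2.2.1 (sdiff_subset.trans hAR) disjoint_sdiff
      rw [hcardT, Fintype.card_fin] at hq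
      have hqH := hq.trans_eq (show _ = (#(H i a X) : ℝ) by simp only [H]; congr!)
      have hmiss := card_forall_notMem_le
        (({i} : Finset (Fin (N + 1))) ×ˢ (univ : Finset (Fin m))) hqH
      refine (Nat.cast_le.2 (card_le_card fun ω hω => ?_)).trans (hmiss.trans ?_)
      · exact mem_filter.2 ⟨mem_univ _, (mem_filter.1 hω).2.2⟩
      gcongr
      rw [card_product, card_singleton, card_univ, Fintype.card_fin, one_mul]
      exact exp_neg_pow_le_of_sample_budget hn0 hδ (hmain i (by omega) a X hv)
        (by exact_mod_cast hv.2.2.2)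
    · have hempty : B (i, a) X = ∅ := filter_eq_empty_iff.2 fun _ _ h => hv h.1
      rw [hempty, card_empty, Nat.cast_zero]
      positivity
  have hunion := card_exists_nonempty_le hB
  have hsub : ({ω : StageSamples n s N m | ∃ d : Fin n → Fin k,
        (∀ j, clusterCount c (stageQuery t j.1 (ω j)) = clusterCount d (stageQuery t j.1 (ω j))) ∧
          Setoid.ker d ≠ Setoid.ker c} : Finset (StageSamples n s N m)) ⊆
      univ.filter fun ω => ∃ p X, X.Nonempty ∧ ω ∈ B p X := by
    intro ω hω
    obtain ⟨d, hd, hne⟩ := (mem_filter.1 hω).2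
    rw [mem_filter]
    refine ⟨mem_univ _, ?_⟩
    by_contra hgood
    push Not at hgood
    refine hne (Setoid.ext fun x y => ?_)
    rw [Setoid.ker_def, Setoid.ker_def]
    refine (eq_iff_eq_of_stages (R := R) (N := N) (by simp [R]) hsat ?_ x y).symm
    intro i hi a ha ha' X hX hXne hcard
    have hv : valid i a X := ⟨ha, ha', hX, hcard⟩
    have hω : ¬ ∀ j ∈ ({⟨i, by omega⟩} : Finset (Fin (N + 1))) ×ˢ (univ : Finset (Fin m)),
        ω j ∉ H i a X := fun h =>
      hgood (⟨i, by omega⟩, a) X hXne (mem_filter.2 ⟨mem_univ _, hv, h⟩)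
    push Not at hω
    obtain ⟨j, hj, hjH⟩ := hω
    rw [mem_product, mem_singleton] at hj
    replace hjH := (mem_filter.1 hjH).2
    have hji : (j.1 : ℕ) = i := by rw [hj.1]
    exact ⟨stageQuery t j.1 (ω j), hd j, by rw [hji]; exact hjH⟩
  refine (Nat.cast_le.2 (card_le_card hsub)).trans (hunion.trans ?_)
  rw [← mul_assoc]
  gcongr
  rw [Fintype.card_prod, Fintype.card_fin, Fintype.card_fin]
  push_cast
  exact union_bound_le hn hN hδ hδ1

end Algorithm

/-- There is a constant `C > 0` such that for all `n ≥ 4`, `2 ≤ k ≤ n`, `δ ∈ (0,1)` and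
`2 ≤ s ≤ √n`, there is a non-adaptive randomized algorithm making at most
`C·(n²/s²)·k·log₂(n/δ)·log₂ log₂ n` subset queries, each query of size at most `s`,
which for every partition of an `n`-point set into at most `k` clusters outputs exactly
that partition with probability at least `1 - δ`. -/
theorem nonadaptive_clustering_bounded_size_optimal :
    ∃ C : ℝ, 0 < C ∧
      ∀ n k : ℕ, 4 ≤ n → 2 ≤ k → k ≤ n →
        ∀ δ : ℝ, 0 < δ → δ < 1 →
          ∀ s : ℕ, 2 ≤ s → (s : ℝ) ≤ Real.sqrt n →
            ∃ m : ℕ,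
              (m : ℝ) ≤ C * ((n : ℝ) ^ 2 / (s : ℝ) ^ 2) * k * Real.logb 2 (n / δ) *
                  Real.logb 2 (Real.logb 2 n) ∧
              ∃ D : PMF ((Fin m → Finset (Fin n)) × ((Fin m → ℕ) → Setoid (Fin n))),
                (∀ a ∈ D.support, ∀ i : Fin m, (a.1 i).card ≤ s) ∧
                ∀ c : Fin n → Fin k,
                  ENNReal.ofReal (1 - δ) ≤
                    D.toOuterMeasure
                      {a | a.2 (fun i => clusterCount c (a.1 i)) = Setoid.ker c} := by
  classical
  refine ⟨512, by norm_num, fun n k hn hk _ δ hδ hδ1 s hs hsn => ?_⟩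
  have hn0 : (0 : ℝ) < n := by positivity
  have hn4 : (4 : ℝ) ≤ n := by exact_mod_cast hn
  have hsn' : (s : ℝ) ^ 2 ≤ n := by
    rw [Real.le_sqrt (by positivity) hn0.le] at hsn
    exact hsn
  obtain ⟨N, t, ht0, htN, ht, hN, hNlog⟩ :=
    exists_doubly_exponential_schedule hn hs (by exact_mod_cast hsn')
  set Λ := Real.logb 2 (n / δ)
  have hΛ1 : 1 ≤ Λ := by
    rw [Real.le_logb_iff_rpow_le one_lt_two (by positivity), Real.rpow_one, le_div_iff₀ hδ]
    linarith
  have hΛ : Real.log (n / δ) ≤ Λ := by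
    have h₁ : Λ * Real.log 2 = Real.log (n / δ) :=
      div_mul_cancel₀ _ (Real.log_pos one_lt_two).ne'
    nlinarith [Real.log_two_lt_d9]
  set q : ℝ := 128 * ((n : ℝ) ^ 2 / (s : ℝ) ^ 2) * k * Λ
  have hs0 : (0 : ℝ) < s := by positivity
  have hk1 : (1 : ℝ) ≤ k := by exact_mod_cast (by omega : 1 ≤ k)
  have hns : 1 ≤ (n : ℝ) ^ 2 / (s : ℝ) ^ 2 := by
    rw [le_div_iff₀ (by positivity)]
    nlinarith
  have hq1 : 1 ≤ q := by
    calc (1 : ℝ) ≤ 128 * 1 * 1 * 1 := by norm_num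
      _ ≤ q := by simp only [q]; gcongr
  set m := ⌈q⌉₊
  have hmq : q ≤ m := Nat.le_ceil q
  have hm2 : (m : ℝ) ≤ 2 * q := by linarith [Nat.ceil_lt_add_one (by linarith : 0 ≤ q)]
  refine ⟨(N + 1) * m, ?_, ?_⟩
  · push_cast at hNlog ⊢
    calc ((N : ℝ) + 1) * m ≤ (2 * Real.logb 2 (Real.logb 2 n)) * (2 * q) := by
          gcongr
          exact le_trans (by positivity) hNlog
      _ = _ := by simp only [q]; ring
  let e : Fin ((N + 1) * m) ≃ Fin (N + 1) × Fin m := finProdFinEquiv.symm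
  let Q : StageSamples n s N m → Fin ((N + 1) * m) → Finset (Fin n) :=
    fun ω i => stageQuery t (e i).1 (ω (e i))
  let g : StageSamples n s N m → (Fin ((N + 1) * m) → ℕ) → Setoid (Fin n) :=
    fun ω r => if h : ∃ d : Fin n → Fin k, (fun i => clusterCount d (Q ω i)) = r then
      Setoid.ker h.choose else ⊥
  have : Nonempty (Fin n) := ⟨⟨0, by omega⟩⟩
  refine ⟨(PMF.uniformOfFintype (StageSamples n s N m)).map fun ω => (Q ω, g ω),
    ?_, fun c => ?_⟩
  · intro a ha i
    obtain ⟨ω, -, rfl⟩ := (PMF.mem_support_map_iff _ _ _).1 ha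
    exact card_stageQuery_le t _ _
  · rw [PMF.toOuterMeasure_map_apply, PMF.toOuterMeasure_uniformOfFintype_apply]
    have hbad := card_ambiguous_samples_le hn hk (by exact_mod_cast hsn') ht0 htN ht hN hδ hδ1
      (m := m) (le_trans (by simp only [q]; gcongr) hmq) c
    set bad : Finset (StageSamples n s N m) := {ω | ∃ d : Fin n → Fin k,
      (∀ j, clusterCount c (stageQuery t j.1 (ω j)) = clusterCount d (stageQuery t j.1 (ω j))) ∧
        Setoid.ker d ≠ Setoid.ker c}
    have hgood : #badᶜ ≤ Fintype.card ((fun ω => (Q ω, g ω)) ⁻¹'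
        {a | a.2 (fun i => clusterCount c (a.1 i)) = Setoid.ker c} : Set (StageSamples n s N m)) := by
      rw [← Set.toFinset_card]
      refine card_le_card fun ω hω => ?_
      simp only [Set.mem_toFinset, Set.mem_preimage, Set.mem_ofPred_eq]
      have h : ∃ d : Fin n → Fin k,
        (fun i => clusterCount d (Q ω i)) = fun i => clusterCount c (Q ω i) := ⟨c, rfl⟩
      simp only [g, dif_pos h]
      by_contra hne
      refine mem_compl.1 hω (mem_filter.2 ⟨mem_univ _, h.choose, fun j => ?_, hne⟩)
      simpa [Q] using (congrFun h.choose_spec (e.symm j)).symm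
    have hsum : (#badᶜ : ℝ) + #bad = Fintype.card (StageSamples n s N m) := by
      exact_mod_cast card_compl_add_card bad
    rw [ENNReal.le_div_iff_mul_le (Or.inl (Nat.cast_ne_zero.2 Fintype.card_ne_zero))
        (Or.inl (ENNReal.natCast_ne_top _)),
      ← ENNReal.ofReal_natCast, ← ENNReal.ofReal_mul (by linarith), ← ENNReal.ofReal_natCast]
    refine ENNReal.ofReal_le_ofReal (le_trans ?_ (Nat.cast_le.2 hgood))
    linarith
end

section
/- Let U be a finite set with |U| = n ≥ 2, and let D be a probability distribution over finite sets Q of 2-element subsets of U (pair queries). Suppose that for every partition of U into at most 3 clusters, with probability at least 2/3 over Q ∼ D, one can recover the partition from the answers (count(q) for q ∈ Q); in particular, for every pair of distinct x, y ∈ U, with probability at least 2/3 over Q ∼ D there exists q ∈ Q on which the partitions P¹_{x,y} = ({x,y}, ∅, U∖{x,y}) and P²_{x,y} = ({x}, {y}, U∖{x,y}) give different answers. Then the expected size of Q satisfies E_{Q∼D}[|Q|] ≥ (2/3) · n(n−1)/2. -/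
open scoped ENNReal

/-- The partition `P¹_{x,y} = ({x,y}, ∅, U∖{x,y})` of `U`, as a labeling into 3 clusters. -/
def pairPart1 {U : Type*} [DecidableEq U] (x y : U) : U → Fin 3 :=
  fun z => if z = x ∨ z = y then 0 else 2

/-- The partition `P²_{x,y} = ({x}, {y}, U∖{x,y})` of `U`, as a labeling into 3 clusters. -/
def pairPart2 {U : Type*} [DecidableEq U] (x y : U) : U → Fin 3 :=
  fun z => if z = x then 0 else if z = y then 1 else 2

/-- A pair query which separates `P¹_{x,y}` from `P²_{x,y}` is the query `{x, y}` itself. -/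
theorem eq_pair_of_clusterCount_ne {U : Type*} [DecidableEq U] {x y : U} {q : Finset U}
    (hq : q.card = 2)
    (h : clusterCount (pairPart1 x y) q ≠ clusterCount (pairPart2 x y) q) : q = {x, y} := by
  obtain ⟨a, b, hab, rfl⟩ := Finset.card_eq_two.mp hq
  contrapose! h
  by_cases hax : a = x <;> by_cases hay : a = y <;> by_cases hbx : b = x <;>
    by_cases hby : b = y <;>
    simp_all [clusterCount, pairPart1, pairPart2, Finset.pair_comm]

/-- If a distribution `D` over finite sets of pair queries on `Fin n` is such that for
every pair of distinct `x, y`, with probability at least `2/3` some query distinguishes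
`P¹_{x,y}` from `P²_{x,y}`, then the expected number of queries is at least
`(2/3)·n(n-1)/2`. -/
theorem nonadaptive_pair_query_lower_bound (n : ℕ) (hn : 2 ≤ n)
    (D : PMF (Finset (Finset (Fin n))))
    (hsize : ∀ Q ∈ D.support, ∀ q ∈ Q, q.card = 2)
    (hdist : ∀ x y : Fin n, x ≠ y →
      (2 / 3 : ℝ≥0∞) ≤ D.toOuterMeasure
        {Q | ∃ q ∈ Q, clusterCount (pairPart1 x y) q ≠ clusterCount (pairPart2 x y) q}) :
    ENNReal.ofReal ((2 / 3) * ((n : ℝ) * ((n : ℝ) - 1) / 2)) ≤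
      ∑' Q : Finset (Finset (Fin n)), D Q * (Q.card : ℝ≥0∞) := by
  have hpair : ∀ p ∈ Finset.powersetCard 2 (Finset.univ : Finset (Fin n)),
      (2 / 3 : ℝ≥0∞) ≤ ∑ Q, if p ∈ Q then D Q else 0 := by
    intro p hp
    obtain ⟨x, y, hxy, rfl⟩ := Finset.card_eq_two.mp (Finset.mem_powersetCard.mp hp).2
    refine (hdist x y hxy).trans ?_
    rw [PMF.toOuterMeasure_apply, tsum_fintype]
    refine Finset.sum_le_sum fun Q _ => ?_
    by_cases hQ : Q ∈ D.support
    · by_cases hmem : Q ∈ {Q : Finset (Finset (Fin n)) | ∃ q ∈ Q,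
          clusterCount (pairPart1 x y) q ≠ clusterCount (pairPart2 x y) q}
      · obtain ⟨q, hqQ, hq⟩ := hmem
        have hxyQ : {x, y} ∈ Q := eq_pair_of_clusterCount_ne (hsize Q hQ q hqQ) hq ▸ hqQ
        rw [if_pos hxyQ]
        exact Set.indicator_le_self _ _ _
      · rw [Set.indicator_of_notMem hmem]
        exact zero_le
    · refine (Set.indicator_le_self _ _ _).trans ?_
      rw [(D.apply_eq_zero_iff Q).mpr hQ]
      exact zero_le
  have hchoose : ENNReal.ofReal ((2 / 3) * ((n : ℝ) * ((n : ℝ) - 1) / 2)) =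
      ∑ _p ∈ Finset.powersetCard 2 (Finset.univ : Finset (Fin n)), (2 / 3 : ℝ≥0∞) := by
    rw [Finset.sum_const, Finset.card_powersetCard, Finset.card_univ, Fintype.card_fin,
      nsmul_eq_mul, ← Nat.cast_choose_two, mul_comm, ENNReal.ofReal_mul (Nat.cast_nonneg _),
      ENNReal.ofReal_natCast, ENNReal.ofReal_div_of_pos three_pos]
    norm_num
  rw [hchoose, tsum_fintype]
  refine (Finset.sum_le_sum hpair).trans ?_
  rw [Finset.sum_comm]
  refine Finset.sum_le_sum fun Q _ => ?_
  rw [← Finset.sum_filter, Finset.sum_const, nsmul_eq_mul, mul_comm]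
  gcongr
  exact fun p hp => (Finset.mem_filter.mp hp).2
end

section
/- Let U be a finite set with |U| = n ≥ 2, let s ≥ 2 be an integer, and let D be a probability distribution over finite sets Q of subsets of U each of size at most s. Suppose that for every pair of distinct x, y ∈ U, with probability at least 2/3 over Q ∼ D there exists q ∈ Q on which the partitions P¹_{x,y} = ({x,y}, ∅, U∖{x,y}) and P²_{x,y} = ({x}, {y}, U∖{x,y}) give different answers count(q). Then the expected size of Q satisfies E_{Q∼D}[|Q|] ≥ (2/3) · (n(n−1)/2) / (s(s−1)/2); in particular any non-adaptive 3-clustering algorithm with queries of size at most s requires Ω(n²/s²) subset queries. -/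
open scoped ENNReal

/-- A query distinguishing `P¹_{x,y}` from `P²_{x,y}` contains both `x` and `y`. -/
theorem mem_and_mem_of_clusterCount_ne {U : Type*} [DecidableEq U] {x y : U} {q : Finset U}
    (h : clusterCount (pairPart1 x y) q ≠ clusterCount (pairPart2 x y) q) :
    x ∈ q ∧ y ∈ q := by
  constructor
  · by_contra hx
    apply h
    have himage : q.image (pairPart2 x y) =
        (q.image (pairPart1 x y)).image (Equiv.swap (0 : Fin 3) 1) := by
      rw [Finset.image_image]
      refine Finset.image_congr fun z hz => ?_
      have hzx : z ≠ x := fun hzx => hx (hzx ▸ hz)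
      by_cases hzy : z = y
      · subst hzy
        simp [pairPart1, pairPart2, hzx]
      · simp only [pairPart1, pairPart2, hzx, hzy, Function.comp, or_self, if_false]
        decide
    rw [clusterCount, clusterCount, himage,
      Finset.card_image_of_injective _ (Equiv.swap (0 : Fin 3) 1).injective]
  · by_contra hy
    apply h
    have himage : q.image (pairPart1 x y) = q.image (pairPart2 x y) := by
      refine Finset.image_congr fun z hz => ?_
      have hzy : z ≠ y := fun hzy => hy (hzy ▸ hz)
      simp [pairPart1, pairPart2, hzy]
    rw [clusterCount, clusterCount, himage]

open Classical in
/-- A set `Q` of queries of size at most `s` distinguishes at most `|Q| (s² - s)` ordered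
pairs of distinct points. -/
theorem card_distinguished_pairs_le {U : Type*} [Fintype U] [DecidableEq U] {s : ℕ}
    {Q : Finset (Finset U)} (hQ : ∀ q ∈ Q, q.card ≤ s) :
    ((Finset.univ : Finset U).offDiag.filter fun p => ∃ q ∈ Q,
      clusterCount (pairPart1 p.1 p.2) q ≠ clusterCount (pairPart2 p.1 p.2) q).card ≤
      Q.card * (s * (s - 1)) := by
  refine le_trans (Finset.card_le_card (t := Q.biUnion Finset.offDiag) ?_)
    (Finset.card_biUnion_le_card_mul _ _ _ fun q hq => ?_)
  · rintro p hp
    obtain ⟨hp, q, hq, hne⟩ := Finset.mem_filter.1 hp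
    obtain ⟨hx, hy⟩ := mem_and_mem_of_clusterCount_ne hne
    exact Finset.mem_biUnion.2 ⟨q, hq, Finset.mem_offDiag.2 ⟨hx, hy, (Finset.mem_offDiag.1 hp).2.2⟩⟩
  · rw [Finset.offDiag_card, ← Nat.mul_sub_one]
    exact Nat.mul_le_mul (hQ q hq) (Nat.sub_le_sub_right (hQ q hq) 1)

/-- If a distribution `D` over finite sets of subset queries of size at most `s` on `Fin n`
is such that for every pair of distinct `x, y`, with probability at least `2/3` some query
distinguishes `P¹_{x,y}` from `P²_{x,y}`, then the expected number of queries is at least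
`(2/3)·(n(n-1)/2)/(s(s-1)/2)`; hence non-adaptive 3-clustering with queries of size at
most `s` needs `Ω(n²/s²)` subset queries. -/
theorem nonadaptive_bounded_query_lower_bound (n : ℕ) (hn : 2 ≤ n) (s : ℕ) (hs : 2 ≤ s)
    (D : PMF (Finset (Finset (Fin n))))
    (hsize : ∀ Q ∈ D.support, ∀ q ∈ Q, q.card ≤ s)
    (hdist : ∀ x y : Fin n, x ≠ y →
      (2 / 3 : ℝ≥0∞) ≤ D.toOuterMeasure
        {Q | ∃ q ∈ Q, clusterCount (pairPart1 x y) q ≠ clusterCount (pairPart2 x y) q}) :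
    ENNReal.ofReal ((2 / 3) * ((n : ℝ) * ((n : ℝ) - 1) / 2) / ((s : ℝ) * ((s : ℝ) - 1) / 2)) ≤
      ∑' Q : Finset (Finset (Fin n)), D Q * (Q.card : ℝ≥0∞) := by
  classical
  have hpairs : (2 / 3 : ℝ≥0∞) * ((n * (n - 1) : ℕ) : ℝ≥0∞) ≤
      (∑' Q : Finset (Finset (Fin n)), D Q * (Q.card : ℝ≥0∞)) * ((s * (s - 1) : ℕ) : ℝ≥0∞) := by
    calc (2 / 3 : ℝ≥0∞) * ((n * (n - 1) : ℕ) : ℝ≥0∞)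
        = ∑ _p ∈ (Finset.univ : Finset (Fin n)).offDiag, (2 / 3 : ℝ≥0∞) := by
          rw [Finset.sum_const, Finset.offDiag_card, Finset.card_univ, Fintype.card_fin,
            ← Nat.mul_sub_one, nsmul_eq_mul, mul_comm]
      _ ≤ ∑ p ∈ (Finset.univ : Finset (Fin n)).offDiag, ∑' Q : Finset (Finset (Fin n)),
            if ∃ q ∈ Q, clusterCount (pairPart1 p.1 p.2) q ≠ clusterCount (pairPart2 p.1 p.2) q
              then D Q else 0 := by
          refine Finset.sum_le_sum fun p hp => (hdist p.1 p.2 (Finset.mem_offDiag.1 hp).2.2).trans ?_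
          rw [PMF.toOuterMeasure_apply]
          exact (tsum_congr fun Q => by simp [Set.indicator_apply]).le
      _ = ∑' Q : Finset (Finset (Fin n)), D Q *
            (((Finset.univ : Finset (Fin n)).offDiag.filter fun p => ∃ q ∈ Q,
              clusterCount (pairPart1 p.1 p.2) q ≠ clusterCount (pairPart2 p.1 p.2) q).card :
                ℝ≥0∞) := by
          rw [← Summable.tsum_finsetSum fun _ _ => ENNReal.summable]
          refine tsum_congr fun Q => ?_
          rw [← Finset.sum_filter, Finset.sum_const, nsmul_eq_mul, mul_comm]
      _ ≤ ∑' Q : Finset (Finset (Fin n)),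
            D Q * (Q.card : ℝ≥0∞) * ((s * (s - 1) : ℕ) : ℝ≥0∞) := by
          refine ENNReal.tsum_le_tsum fun Q => ?_
          by_cases hQ : Q ∈ D.support
          · rw [mul_assoc, ← Nat.cast_mul]
            exact mul_le_mul_right (Nat.cast_le.2 (card_distinguished_pairs_le (hsize Q hQ))) _
          · simp [(D.apply_eq_zero_iff Q).2 hQ]
      _ = _ := ENNReal.tsum_mul_right
  have hspos : (0 : ℝ) < ((s * (s - 1) : ℕ) : ℝ) :=
    Nat.cast_pos.2 (Nat.mul_pos (by omega) (by omega))
  have hreal : (2 / 3) * ((n : ℝ) * ((n : ℝ) - 1) / 2) / ((s : ℝ) * ((s : ℝ) - 1) / 2) =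
      (2 / 3) * ((n * (n - 1) : ℕ) : ℝ) / ((s * (s - 1) : ℕ) : ℝ) := by
    rw [Nat.cast_mul, Nat.cast_mul, Nat.cast_pred (by omega), Nat.cast_pred (by omega),
      ← mul_div_assoc, div_div_div_cancel_right₀ two_ne_zero]
  rw [hreal, ENNReal.ofReal_div_of_pos hspos, ENNReal.ofReal_mul (by norm_num),
    ENNReal.ofReal_div_of_pos (by norm_num), ENNReal.ofReal_natCast, ENNReal.ofReal_natCast,
    ENNReal.ofReal_ofNat, ENNReal.ofReal_ofNat]
  exact ENNReal.div_le_of_le_mul hpairs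
end
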